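/- arXiv:2405.16647 — 7 statements merged into one kernel-verified Lean document; each statement's English description precedes it below -/
import Mathlib

section
/- Let p be an odd prime, n a positive integer, q = p^n, and let F be a finite field with exactly q elements. For every function f : F² → ℂ one has ∑_{(ξ,τ) ∈ F²×F} | ∑_{(ξ₁,ξ₂) ∈ F²×F² with ξ₁+ξ₂=ξ and ξ₁·ξ₁+ξ₂·ξ₂=τ} f(ξ₁)·f(ξ₂) |² ≤ (q + 1 − 1/q) · ( ∑_{ξ ∈ F²} |f(ξ)|² )², and equality holds whenever f is a constant function. (This is the combinatorial form of the sharp L²→L⁴ extension inequality from the paraboloid P² ⊂ F³, with best constant R*_{P²}(2→4) = (1 + q⁻¹ − q⁻²)^{1/4}.) -/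
open Finset

/-- The orthogonal complement of a nonzero vector of the plane has as many points as the field. -/
theorem card_filter_orthogonal {F : Type*} [Field F] [Fintype F] [DecidableEq F]
    {u : F × F} (hu : u ≠ 0) :
    #{v : F × F | u.1 * v.1 + u.2 * v.2 = 0} = Fintype.card F := by
  have himage : ({v : F × F | u.1 * v.1 + u.2 * v.2 = 0} : Finset (F × F)) =
      univ.image (fun t : F => (-u.2 * t, u.1 * t)) := by
    ext ⟨x, y⟩
    simp only [mem_filter, mem_univ, true_and, mem_image, Prod.mk.injEq]
    constructor
    · intro h
      by_cases h1 : u.1 = 0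
      · have h2 : u.2 ≠ 0 := fun h2 => hu (Prod.ext h1 h2)
        have hy : y = 0 := by simpa [h1, h2] using h
        exact ⟨-x / u.2, by field_simp, by simp [h1, hy]⟩
      · refine ⟨y / u.1, ?_, by field_simp⟩
        field_simp
        linear_combination -h
    · rintro ⟨t, rfl, rfl⟩
      ring
  have hinj : Function.Injective (fun t : F => (-u.2 * t, u.1 * t)) := by
    intro s t hst
    simp only [Prod.mk.injEq] at hst
    by_cases h1 : u.1 = 0
    · have h2 : u.2 ≠ 0 := fun h2 => hu (Prod.ext h1 h2)
      exact mul_left_cancel₀ (neg_ne_zero.mpr h2) hst.1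
    · exact mul_left_cancel₀ h1 hst.2
  rw [himage, card_image_of_injective _ hinj, card_univ]

/-- Summing the squared fibre sums of `G` over the values of `k` is summing `G y * G z` over the
pairs with `k y = k z`. -/
theorem sum_sq_sum_fiber {α β : Type*} [Fintype α] [Fintype β] [DecidableEq β]
    (k : α → β) (G : α → ℝ) :
    ∑ b, (∑ y with k y = b, G y) ^ 2 =
      ∑ w : α × α with k w.1 = k w.2, G w.1 * G w.2 := by
  simp_rw [sq, sum_mul_sum, sum_filter, Fintype.sum_prod_type]
  rw [sum_comm]
  refine sum_congr rfl fun y _ => ?_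
  simp only [sum_ite_eq, mem_univ, if_true]
  exact sum_congr rfl fun z _ => by simp [eq_comm]

/-- Two points of the paraboloid having the same sum as two others are the opposite corners of
a rectangle. -/
theorem sum_energy_eq_sum_rectangle {F : Type*} [Field F] [Fintype F] [DecidableEq F]
    (h2 : (2 : F) ≠ 0) (g : F × F → ℝ) :
    ∑ ξτ : (F × F) × F,
        (∑ y ∈ univ.filter (fun y : (F × F) × (F × F) =>
            y.1 + y.2 = ξτ.1 ∧
            (y.1.1 ^ 2 + y.1.2 ^ 2) + (y.2.1 ^ 2 + y.2.2 ^ 2) = ξτ.2),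
          g y.1 * g y.2) ^ 2 =
      ∑ u : F × F, ∑ v with u.1 * v.1 + u.2 * v.2 = 0,
        ∑ a, (g a * g (a + u)) * (g (a + v) * g (a + u + v)) := by
  have hfiber := sum_sq_sum_fiber
    (fun y : (F × F) × (F × F) =>
      (y.1 + y.2, (y.1.1 ^ 2 + y.1.2 ^ 2) + (y.2.1 ^ 2 + y.2.2 ^ 2)))
    (fun y => g y.1 * g y.2)
  simp only [Prod.ext_iff] at hfiber ⊢
  refine hfiber.trans ?_
  have htriple : ∑ u : F × F, ∑ v with u.1 * v.1 + u.2 * v.2 = 0,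
        ∑ a, (g a * g (a + u)) * (g (a + v) * g (a + u + v)) =
      ∑ t : ((F × F) × (F × F)) × (F × F) with t.1.1.1 * t.1.2.1 + t.1.1.2 * t.1.2.2 = 0,
        (g t.2 * g (t.2 + t.1.1)) * (g (t.2 + t.1.2) * g (t.2 + t.1.1 + t.1.2)) := by
    rw [sum_filter (s := (univ : Finset (((F × F) × (F × F)) × (F × F)))),
      Fintype.sum_prod_type (α₁ := (F × F) × (F × F)),
      Fintype.sum_prod_type (α₁ := F × F) (α₂ := F × F)]
    refine sum_congr rfl fun u _ => ?_
    rw [sum_filter]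
    refine sum_congr rfl fun v _ => ?_
    split_ifs <;> simp
  rw [htriple]
  refine sum_bij' (fun w _ => ((w.2.1 - w.1.1, w.2.2 - w.1.1), w.1.1))
    (fun t _ => ((t.2, t.2 + t.1.1 + t.1.2), (t.2 + t.1.1, t.2 + t.1.2))) ?_ ?_ ?_ ?_ ?_
  · rintro ⟨⟨⟨a1, a2⟩, ⟨d1, d2⟩⟩, ⟨⟨b1, b2⟩, ⟨c1, c2⟩⟩⟩ h
    simp only [mem_filter, mem_univ, true_and, Prod.mk_add_mk, Prod.mk_sub_mk] at h ⊢
    obtain ⟨⟨h1, h2'⟩, h3⟩ := h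
    obtain rfl : d1 = b1 + c1 - a1 := by linear_combination h1
    obtain rfl : d2 = b2 + c2 - a2 := by linear_combination h2'
    refine mul_left_cancel₀ h2 ?_
    linear_combination h3
  · rintro ⟨⟨⟨u1, u2⟩, ⟨v1, v2⟩⟩, ⟨a1, a2⟩⟩ h
    simp only [mem_filter, mem_univ, true_and, Prod.mk_add_mk] at h ⊢
    refine ⟨⟨by ring, by ring⟩, ?_⟩
    linear_combination 2 * h
  · rintro ⟨⟨⟨a1, a2⟩, ⟨d1, d2⟩⟩, ⟨⟨b1, b2⟩, ⟨c1, c2⟩⟩⟩ h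
    simp only [mem_filter, mem_univ, true_and, Prod.mk_add_mk] at h
    simp only [Prod.mk_add_mk, Prod.mk_sub_mk, Prod.mk.injEq, true_and]
    refine ⟨⟨?_, ?_⟩, ⟨by ring, by ring⟩, by ring, by ring⟩
    · linear_combination -h.1.1
    · linear_combination -h.1.2
  · rintro ⟨⟨u, v⟩, a⟩ _
    simp
  · rintro ⟨⟨⟨a1, a2⟩, ⟨d1, d2⟩⟩, ⟨⟨b1, b2⟩, ⟨c1, c2⟩⟩⟩ h
    simp only [mem_filter, mem_univ, true_and, Prod.mk_add_mk] at h
    obtain ⟨⟨h1, h2'⟩, -⟩ := h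
    obtain rfl : d1 = b1 + c1 - a1 := by linear_combination h1
    obtain rfl : d2 = b2 + c2 - a2 := by linear_combination h2'
    simp only [Prod.mk_add_mk, Prod.mk_sub_mk, add_sub_cancel, add_sub_assoc]
    ring

/-- The weighted count of rectangles is bounded by pairing opposite sides. -/
theorem sum_rectangle_le {F : Type*} [Field F] [Fintype F] [DecidableEq F] (g : F × F → ℝ) :
    ∑ u : F × F, ∑ v with u.1 * v.1 + u.2 * v.2 = 0,
        ∑ a, (g a * g (a + u)) * (g (a + v) * g (a + u + v)) ≤
      (Fintype.card F + 1) * (∑ a, g a ^ 2) ^ 2 - Fintype.card F * ∑ a, g a ^ 4 := by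
  set T := ∑ a, g a ^ 2 with hT
  let φ : F × F → ℝ := fun u => ∑ a, g a ^ 2 * g (a + u) ^ 2
  have hφ0 : φ 0 = ∑ a, g a ^ 4 := sum_congr rfl fun a _ => by rw [add_zero]; ring
  have hφ : ∑ u, φ u = T ^ 2 := by
    rw [sum_comm, sq, hT, sum_mul]
    refine sum_congr rfl fun a _ => ?_
    rw [← mul_sum, ← Equiv.sum_comp (Equiv.addLeft a) (fun b => g b ^ 2)]
    rfl
  have hu (u : F × F) : ∑ v with u.1 * v.1 + u.2 * v.2 = 0,
        ∑ a, (g a * g (a + u)) * (g (a + v) * g (a + u + v)) ≤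
      Fintype.card F * φ u + if u = 0 then T ^ 2 - Fintype.card F * φ 0 else 0 := by
    by_cases h : u = 0
    · subst h
      simp only [Prod.fst_zero, Prod.snd_zero, zero_mul, add_zero, filter_true, if_true]
      rw [add_sub_cancel, ← hφ]
      exact (sum_congr rfl fun v _ => sum_congr rfl fun a _ => by ring).le
    · rw [if_neg h, add_zero, ← card_filter_orthogonal h, ← nsmul_eq_mul]
      refine sum_le_card_nsmul _ _ _ fun v _ => ?_
      have hshift : ∑ a, g (a + v) ^ 2 * g (a + u + v) ^ 2 = φ u := by
        refine Eq.trans ?_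
          (Equiv.sum_comp (Equiv.addRight v) (fun a => g a ^ 2 * g (a + u) ^ 2))
        exact sum_congr rfl fun a _ => by simp [add_right_comm]
      have hmean : ∑ a, (g a * g (a + u)) * (g (a + v) * g (a + u + v)) ≤
          ∑ a, (g a ^ 2 * g (a + u) ^ 2 + g (a + v) ^ 2 * g (a + u + v) ^ 2) / 2 :=
        sum_le_sum fun a _ => by
          linarith [two_mul_le_add_sq (g a * g (a + u)) (g (a + v) * g (a + u + v)),
            mul_pow (g a) (g (a + u)) 2, mul_pow (g (a + v)) (g (a + u + v)) 2]
      rw [← sum_div, sum_add_distrib, hshift] at hmean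
      exact hmean.trans_eq (add_self_div_two _)
  refine (sum_le_sum fun u _ => hu u).trans_eq ?_
  rw [sum_add_distrib, ← mul_sum, hφ, sum_ite_eq', if_pos (mem_univ _), hφ0]
  ring

/-- The number of ordered pairs of orthogonal vectors of the plane. -/
theorem sum_card_filter_orthogonal {F : Type*} [Field F] [Fintype F] [DecidableEq F] :
    ∑ u : F × F, (#{v : F × F | u.1 * v.1 + u.2 * v.2 = 0} : ℝ) =
      (Fintype.card F : ℝ) ^ 3 + (Fintype.card F : ℝ) ^ 2 - Fintype.card F := by
  have hu (u : F × F) : (#{v : F × F | u.1 * v.1 + u.2 * v.2 = 0} : ℝ) =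
      Fintype.card F + if u = 0 then (Fintype.card F : ℝ) ^ 2 - Fintype.card F else 0 := by
    by_cases h : u = 0
    · subst h
      simp [sq]
    · rw [if_neg h, add_zero, card_filter_orthogonal h]
  simp_rw [hu]
  rw [sum_add_distrib, sum_ite_eq', if_pos (mem_univ _)]
  simp only [sum_const, card_univ, Fintype.card_prod, nsmul_eq_mul, Nat.cast_mul]
  ring

/-- Sharp L²→L⁴ extension inequality from the paraboloid P² ⊂ F³ in combinatorial form,
with equality for constant functions. -/
theorem parabola_P2_sharp_L2_L4_extension
    (p n q : ℕ) (hp : p.Prime) (hp2 : p ≠ 2) (hn : 0 < n) (hq : q = p ^ n)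
    (F : Type) [Field F] [Fintype F] [DecidableEq F] (hF : Fintype.card F = q)
    (f : F × F → ℂ) :
    (∑ ξτ : (F × F) × F,
        ‖∑ y ∈ univ.filter (fun y : (F × F) × (F × F) =>
            y.1 + y.2 = ξτ.1 ∧
            (y.1.1 ^ 2 + y.1.2 ^ 2) + (y.2.1 ^ 2 + y.2.2 ^ 2) = ξτ.2),
          f y.1 * f y.2‖ ^ 2)
      ≤ ((q : ℝ) + 1 - 1 / q) * (∑ ξ : F × F, ‖f ξ‖ ^ 2) ^ 2
    ∧ (∀ c : ℂ, (∀ ξ, f ξ = c) →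
      (∑ ξτ : (F × F) × F,
        ‖∑ y ∈ univ.filter (fun y : (F × F) × (F × F) =>
            y.1 + y.2 = ξτ.1 ∧
            (y.1.1 ^ 2 + y.1.2 ^ 2) + (y.2.1 ^ 2 + y.2.2 ^ 2) = ξτ.2),
          f y.1 * f y.2‖ ^ 2)
      = ((q : ℝ) + 1 - 1 / q) * (∑ ξ : F × F, ‖f ξ‖ ^ 2) ^ 2) := by
  have h2 : (2 : F) ≠ 0 := by
    refine Ring.two_ne_zero fun hchar => hp2 ?_
    have heven : 2 ∣ p ^ n := by
      rw [← hq, ← hF]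
      exact Nat.dvd_of_mod_eq_zero (FiniteField.even_card_of_char_two hchar)
    exact ((Nat.prime_dvd_prime_iff_eq Nat.prime_two hp).mp
      (Nat.prime_two.dvd_of_dvd_pow heven)).symm
  have hq0 : (0 : ℝ) < q := by
    rw [← hF]
    exact_mod_cast Fintype.card_pos
  have hcard : (Fintype.card F : ℝ) = q := by rw [hF]
  have henergy := sum_energy_eq_sum_rectangle h2 (fun ξ => ‖f ξ‖)
  constructor
  · have hle := sum_rectangle_le (fun ξ => ‖f ξ‖)
    rw [← henergy, hcard] at hle
    have hcs : (∑ ξ, ‖f ξ‖ ^ 2) ^ 2 ≤ (q : ℝ) ^ 2 * ∑ ξ, ‖f ξ‖ ^ 4 := by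
      have h := sq_sum_le_card_mul_sum_sq (s := univ) (f := fun ξ => ‖f ξ‖ ^ 2)
      simpa [hF, ← pow_mul, ← sq] using h
    have hdiv : 1 / (q : ℝ) * (∑ ξ, ‖f ξ‖ ^ 2) ^ 2 ≤ q * ∑ ξ, ‖f ξ‖ ^ 4 := by
      rw [one_div, inv_mul_le_iff₀ hq0]
      linarith
    refine le_trans (sum_le_sum fun ξτ _ => ?_) (hle.trans (by linarith))
    refine pow_le_pow_left₀ (norm_nonneg _) ((norm_sum_le _ _).trans_eq ?_) 2
    simp only [norm_mul]
  · intro c hc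
    have hnorm (s : Finset ((F × F) × (F × F))) :
        ‖∑ y ∈ s, f y.1 * f y.2‖ = ∑ y ∈ s, ‖f y.1‖ * ‖f y.2‖ := by
      simp [hc]
    simp_rw [hnorm]
    rw [henergy]
    simp only [hc, sum_const, nsmul_eq_mul, card_univ, Fintype.card_prod, Nat.cast_mul]
    rw [← sum_mul, sum_card_filter_orthogonal, hcard]
    field_simp
end

section
/- Let p be an odd prime, n a positive integer, q = p^n, and let F be a finite field with exactly q elements. If a function f : F² → ℂ attains equality in the inequality ∑_{(ξ,τ) ∈ F²×F} | ∑_{(ξ₁,ξ₂) ∈ F²×F² with ξ₁+ξ₂=ξ and ξ₁·ξ₁+ξ₂·ξ₂=τ} f(ξ₁)·f(ξ₂) |² ≤ (q + 1 − 1/q) · ( ∑_{ξ ∈ F²} |f(ξ)|² )², then |f| is constant on F², i.e. there exists c ≥ 0 with |f(ξ)| = c for all ξ ∈ F². -/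
open Finset

section Energy

variable {F : Type} [Field F] [Fintype F]

theorem sq_sum_mul_le {ι : Type*} (T : Finset ι) (a b : ι → ℝ) {N : ℝ} (hN : (#T : ℝ) ≤ N) :
    (∑ η ∈ T, a η * b η) ^ 2 ≤ N * ∑ η ∈ T, a η ^ 2 * b η ^ 2 := by
  calc _ ≤ #T * ∑ η ∈ T, (a η * b η) ^ 2 := sq_sum_le_card_mul_sum_sq
    _ ≤ N * ∑ η ∈ T, (a η * b η) ^ 2 := by gcongr
    _ = _ := by simp only [mul_pow]

/-- Summation over all pairs of points, parametrized by midpoint and half difference. -/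
theorem sum_sum_add_mul_sub (h2 : (2 : F) ≠ 0) (g : F × F → ℝ) :
    ∑ c, ∑ η, g (c + η) * g (c - η) = (∑ ξ, g ξ) ^ 2 := by
  rw [sq, Fintype.sum_mul_sum, ← Fintype.sum_prod_type', ← Fintype.sum_prod_type']
  refine Fintype.sum_bijective (fun x : (F × F) × (F × F) => (x.1 + x.2, x.1 - x.2)) ?_ _ _
    fun _ => rfl
  rw [← Finite.injective_iff_bijective]
  rintro ⟨⟨a, b⟩, c, d⟩ ⟨⟨a', b'⟩, c', d'⟩ h
  simp only [Prod.mk_add_mk, Prod.mk_sub_mk, Prod.mk.injEq] at h ⊢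
  obtain ⟨⟨h1, h3⟩, h4, h5⟩ := h
  refine ⟨⟨?_, ?_⟩, ?_, ?_⟩ <;> apply mul_left_cancel₀ h2
  · linear_combination h1 + h4
  · linear_combination h3 + h5
  · linear_combination h1 - h4
  · linear_combination h3 - h5

theorem sum_isotropic_mul_isotropic (h2 : (2 : F) ≠ 0) {i : F} (hi : i ^ 2 = -1)
    (g : F × F → ℝ) :
    ∑ c, (∑ t, g (c + (t, i * t))) * (∑ t, g (c + (t, -(i * t)))) = (∑ ξ, g ξ) ^ 2 := by
  have hi0 : i ≠ 0 := by rintro rfl; simp at hi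
  simp_rw [sq, Fintype.sum_mul_sum, ← Fintype.sum_prod_type']
  refine Fintype.sum_bijective (fun x : (F × F) × (F × F) =>
    (x.1 + (x.2.1, i * x.2.1), x.1 + (x.2.2, -(i * x.2.2)))) ?_ _ _ fun _ => rfl
  rw [← Finite.injective_iff_bijective]
  rintro ⟨⟨a, b⟩, c, d⟩ ⟨⟨a', b'⟩, c', d'⟩ h
  simp only [Prod.mk_add_mk, Prod.mk.injEq] at h ⊢
  obtain ⟨⟨h1, h3⟩, h4, h5⟩ := h
  have hc : c = c' := mul_left_cancel₀ (mul_ne_zero h2 hi0)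
    (by linear_combination i * (h1 - h4) + h3 - h5)
  have hd : d = d' := mul_left_cancel₀ (mul_ne_zero h2 hi0)
    (by linear_combination -i * (h1 - h4) + h3 - h5)
  subst hc hd
  exact ⟨⟨add_right_cancel h1, add_right_cancel h3⟩, rfl, rfl⟩

theorem sum_add_mul_sub_le_sum_sq {w : F → F × F} (hw : ∀ t, w (-t) = -w t)
    (h : F × F → ℝ) (c : F × F) :
    ∑ t, h (c + w t) * h (c - w t) ≤ ∑ t, h (c + w t) ^ 2 := by
  have hneg : ∑ t, h (c - w t) ^ 2 = ∑ t, h (c + w t) ^ 2 :=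
    Fintype.sum_equiv (Equiv.neg F) _ _ fun t => by simp [hw, sub_eq_add_neg]
  have : ∑ t, 2 * (h (c + w t) * h (c - w t)) ≤ ∑ t, (h (c + w t) ^ 2 + h (c - w t) ^ 2) :=
    sum_le_sum fun t _ => by nlinarith [sq_nonneg (h (c + w t) - h (c - w t))]
  rw [← mul_sum, sum_add_distrib, hneg] at this
  linarith

variable [DecidableEq F]

/-- The points of the circle `η · η = s` in the plane. -/
def planeCircle (F : Type) [Field F] [Fintype F] [DecidableEq F] (s : F) : Finset (F × F) :=
  univ.filter fun η => η.1 ^ 2 + η.2 ^ 2 = s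

theorem mem_planeCircle {s : F} {η : F × F} :
    η ∈ planeCircle F s ↔ η.1 ^ 2 + η.2 ^ 2 = s := by
  simp [planeCircle]

theorem sum_sum_planeCircle (φ : F × F → ℝ) :
    ∑ s, ∑ η ∈ planeCircle F s, φ η = ∑ η, φ η := by
  simpa [planeCircle] using sum_fiberwise univ (fun η : F × F => η.1 ^ 2 + η.2 ^ 2) φ

theorem card_planeCircle_le_add_one (h2 : (2 : F) ≠ 0) {s : F} (hs : s ≠ 0) :
    #(planeCircle F s) ≤ Fintype.card F + 1 := by
  rcases (planeCircle F s).eq_empty_or_nonempty with h | ⟨⟨a₀, b₀⟩, h₀⟩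
  · simp [h]
  rw [mem_planeCircle] at h₀
  simp only at h₀
  rw [← Fintype.card_option, ← card_univ]
  refine card_le_card_of_injOn
    (fun η : F × F => if s + (η.1 * a₀ + η.2 * b₀) = 0 then none
      else some ((η.2 * a₀ - η.1 * b₀) / (s + (η.1 * a₀ + η.2 * b₀)))) (by simp) ?_
  rintro ⟨a, b⟩ h ⟨a', b'⟩ h' hab
  rw [mem_coe, mem_planeCircle] at h h'
  simp only at h h' hab
  obtain ⟨α, hα⟩ : ∃ α, α = a * a₀ + b * b₀ := ⟨_, rfl⟩
  obtain ⟨β, hβ⟩ : ∃ β, β = b * a₀ - a * b₀ := ⟨_, rfl⟩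
  obtain ⟨α', hα'⟩ : ∃ α', α' = a' * a₀ + b' * b₀ := ⟨_, rfl⟩
  obtain ⟨β', hβ'⟩ : ∃ β', β' = b' * a₀ - a' * b₀ := ⟨_, rfl⟩
  have e : α ^ 2 + β ^ 2 = s ^ 2 := by
    rw [hα, hβ]; linear_combination (a₀ ^ 2 + b₀ ^ 2) * h + s * h₀
  have e' : α' ^ 2 + β' ^ 2 = s ^ 2 := by
    rw [hα', hβ']; linear_combination (a₀ ^ 2 + b₀ ^ 2) * h' + s * h₀
  rw [← hα, ← hβ, ← hα', ← hβ'] at hab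
  have key : α = α' ∧ β = β' := by
    split_ifs at hab with h1 h3 h3
    · have : β ^ 2 = 0 := by linear_combination e + (s - α) * h1
      have hb : β = 0 := by simpa using this
      have : β' ^ 2 = 0 := by linear_combination e' + (s - α') * h3
      have hb' : β' = 0 := by simpa using this
      exact ⟨by linear_combination h1 - h3, by rw [hb, hb']⟩
    · rw [Option.some.injEq, div_eq_div_iff h1 h3] at hab
      have : (α - α') * (2 * s) * ((s + α) * (s + α')) = 0 := by
        linear_combination (-β * (s + α') - β' * (s + α)) * hab
          + (s + α') ^ 2 * e - (s + α) ^ 2 * e'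
      have hαα : α = α' := by
        simpa [h1, h3, h2, hs, sub_eq_zero] using this
      refine ⟨hαα, ?_⟩
      rw [hαα] at hab
      exact mul_right_cancel₀ h3 hab
  obtain ⟨k1, k2⟩ := key
  have x1 : (a - a') * s = 0 := by
    linear_combination a₀ * (k1 - hα + hα') - b₀ * (k2 - hβ + hβ') - (a - a') * h₀
  have x2 : (b - b') * s = 0 := by
    linear_combination b₀ * (k1 - hα + hα') + a₀ * (k2 - hβ + hβ') - (b - b') * h₀
  simp only [mul_eq_zero, hs, or_false, sub_eq_zero] at x1 x2
  rw [x1, x2]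

theorem card_planeCircle_le_sub_one (h2 : (2 : F) ≠ 0) {i : F} (hi : i ^ 2 = -1)
    {s : F} (hs : s ≠ 0) : #(planeCircle F s) ≤ Fintype.card F - 1 := by
  rw [← card_univ, ← card_erase_of_mem (mem_univ (0 : F))]
  have hi0 : i ≠ 0 := by rintro rfl; simp at hi
  refine card_le_card_of_injOn (fun η : F × F => η.1 + i * η.2) ?_ ?_
  · rintro ⟨a, b⟩ h
    rw [mem_coe, mem_planeCircle] at h
    simp only [coe_erase, coe_univ, Set.mem_sdiff, Set.mem_univ, true_and, Set.mem_singleton_iff]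
      at h ⊢
    intro h0
    exact hs (by linear_combination -h + (a - i * b) * h0 + b ^ 2 * hi)
  · rintro ⟨a, b⟩ h ⟨a', b'⟩ h' hab
    rw [mem_coe, mem_planeCircle] at h h'
    simp only at h h' hab
    have hx : a + i * b ≠ 0 := by
      intro h0
      exact hs (by linear_combination -h + (a - i * b) * h0 + b ^ 2 * hi)
    have hy : a - i * b = a' - i * b' := by
      apply mul_left_cancel₀ hx
      linear_combination h - h' - (b ^ 2 - b' ^ 2) * hi - (a' - i * b') * hab
    have ha : a = a' := mul_left_cancel₀ h2 (by linear_combination hab + hy)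
    have hb : b = b' := mul_left_cancel₀ (mul_ne_zero h2 hi0) (by linear_combination hab - hy)
    rw [ha, hb]

theorem sum_planeCircle_zero_add (h2 : (2 : F) ≠ 0) {i : F} (hi : i ^ 2 = -1)
    (φ : F × F → ℝ) :
    ∑ η ∈ planeCircle F 0, φ η + φ 0 = ∑ t, φ (t, i * t) + ∑ t, φ (t, -(i * t)) := by
  have hi0 : i ≠ 0 := by rintro rfl; simp at hi
  have hu : Function.Injective fun t : F => (t, i * t) := fun _ _ h => (Prod.ext_iff.1 h).1
  have hv : Function.Injective fun t : F => (t, -(i * t)) := fun _ _ h => (Prod.ext_iff.1 h).1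
  have hunion : planeCircle F 0 =
      univ.image (fun t : F => (t, i * t)) ∪ univ.image (fun t : F => (t, -(i * t))) := by
    ext ⟨a, b⟩
    simp only [mem_planeCircle, mem_union, mem_image, mem_univ, true_and, Prod.mk.injEq,
      exists_eq_left]
    constructor
    · intro h
      have : (i * a - b) * (i * a + b) = 0 := by linear_combination a ^ 2 * hi - h
      rcases mul_eq_zero.1 this with h | h
      · exact Or.inl (by linear_combination h)
      · exact Or.inr (by linear_combination -h)
    · rintro (rfl | rfl) <;> linear_combination a ^ 2 * hi
  have hinter : {(0 : F × F)} =
      univ.image (fun t : F => (t, i * t)) ∩ univ.image (fun t : F => (t, -(i * t))) := by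
    ext ⟨a, b⟩
    simp only [mem_singleton, mem_inter, mem_image, mem_univ, true_and, Prod.mk.injEq,
      exists_eq_left, Prod.mk_eq_zero]
    constructor
    · rintro ⟨rfl, rfl⟩; simp
    · rintro ⟨h, h'⟩
      have : a = 0 := by
        have : 2 * i * a = 0 := by linear_combination h - h'
        simpa [h2, hi0] using this
      exact ⟨this, by rw [← h, this, mul_zero]⟩
  rw [← sum_singleton φ (0 : F × F), hunion, hinter, sum_union_inter,
    sum_image hu.injOn, sum_image hv.injOn]

theorem planeCircle_zero_eq_singleton (hns : ¬ IsSquare (-1 : F)) : planeCircle F 0 = {0} := by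
  ext ⟨a, b⟩
  simp only [mem_planeCircle, mem_singleton, Prod.mk_eq_zero]
  constructor
  · intro h
    have ha : a = 0 := by
      by_contra ha
      refine hns ⟨b / a, ?_⟩
      field_simp
      linear_combination -h
    exact ⟨ha, by simpa [ha] using h⟩
  · rintro ⟨rfl, rfl⟩; simp

theorem sum_sq_sum_planeCircle_le_of_not_isSquare (h2 : (2 : F) ≠ 0)
    (hns : ¬ IsSquare (-1 : F)) (h : F × F → ℝ) :
    ∑ c, ∑ s, (∑ η ∈ planeCircle F s, h (c + η) * h (c - η)) ^ 2 ≤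
      (Fintype.card F + 1) * (∑ ξ, h ξ ^ 2) ^ 2 - Fintype.card F * ∑ ξ, h ξ ^ 4 := by
  have key (c : F × F) : ∑ s, (∑ η ∈ planeCircle F s, h (c + η) * h (c - η)) ^ 2 ≤
      (Fintype.card F + 1) * ∑ η, h (c + η) ^ 2 * h (c - η) ^ 2 - Fintype.card F * h c ^ 4 := by
    calc _ ≤ ∑ s, ((Fintype.card F + 1) *
            (∑ η ∈ planeCircle F s, h (c + η) ^ 2 * h (c - η) ^ 2)
              - if s = 0 then Fintype.card F * h c ^ 4 else 0) := by
          refine sum_le_sum fun s _ => ?_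
          split_ifs with hs
          · subst hs
            simp only [planeCircle_zero_eq_singleton hns, sum_singleton, add_zero, sub_zero]
            exact le_of_eq (by ring)
          · rw [sub_zero]
            exact sq_sum_mul_le _ _ _ (mod_cast card_planeCircle_le_add_one h2 hs)
      _ = _ := by
          rw [sum_sub_distrib, ← mul_sum, sum_sum_planeCircle]
          simp
  refine (sum_le_sum fun c _ => key c).trans_eq ?_
  rw [sum_sub_distrib, ← mul_sum, ← mul_sum, sum_sum_add_mul_sub h2 fun ξ => h ξ ^ 2]

theorem sum_sq_sum_planeCircle_le_of_sq_eq (h2 : (2 : F) ≠ 0) {i : F} (hi : i ^ 2 = -1)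
    (h : F × F → ℝ) (h0 : ∀ ξ, 0 ≤ h ξ) :
    ∑ c, ∑ s, (∑ η ∈ planeCircle F s, h (c + η) * h (c - η)) ^ 2 ≤
      (Fintype.card F + 1) * (∑ ξ, h ξ ^ 2) ^ 2 - Fintype.card F * ∑ ξ, h ξ ^ 4 := by
  have hcard : ((Fintype.card F - 1 : ℕ) : ℝ) = Fintype.card F - 1 := by
    rw [Nat.cast_sub Fintype.card_pos, Nat.cast_one]
  have herase (w : F → F × F) (hw : w 0 = 0) (c : F × F) :
      ((∑ t, h (c + w t) * h (c - w t)) - h c ^ 2) ^ 2 ≤ (Fintype.card F - 1) *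
        ((∑ t, h (c + w t) ^ 2 * h (c - w t) ^ 2) - h c ^ 4) := by
    have := sq_sum_mul_le (univ.erase (0 : F)) (fun t => h (c + w t)) (fun t => h (c - w t))
      (N := Fintype.card F - 1) (by simp [← hcard])
    rw [sum_erase_eq_sub (mem_univ _), sum_erase_eq_sub (mem_univ _), hw] at this
    convert this using 3 <;> simp <;> ring
  have hzero (c : F × F) : (∑ η ∈ planeCircle F 0, h (c + η) * h (c - η)) ^ 2 ≤
      (Fintype.card F - 1) * (∑ η ∈ planeCircle F 0, h (c + η) ^ 2 * h (c - η) ^ 2)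
        + (2 * ((∑ t, h (c + (t, i * t)) ^ 2) * (∑ t, h (c + (t, -(i * t))) ^ 2))
          - Fintype.card F * h c ^ 4) := by
    have e1 := sum_planeCircle_zero_add h2 hi fun η => h (c + η) * h (c - η)
    have e2 := sum_planeCircle_zero_add h2 hi fun η => h (c + η) ^ 2 * h (c - η) ^ 2
    have u1 := herase (fun t => (t, i * t)) (by simp) c
    have v1 := herase (fun t => (t, -(i * t))) (by simp) c
    have u2 := sum_add_mul_sub_le_sum_sq (w := fun t => (t, i * t)) (by simp) h c
    have v2 := sum_add_mul_sub_le_sum_sq (w := fun t => (t, -(i * t))) (by simp) h c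
    have v0 : 0 ≤ ∑ t, h (c + (t, -(i * t))) * h (c - (t, -(i * t))) :=
      sum_nonneg fun t _ => mul_nonneg (h0 _) (h0 _)
    have u0 : 0 ≤ ∑ t, h (c + (t, i * t)) ^ 2 := sum_nonneg fun t _ => sq_nonneg _
    simp only [add_zero, sub_zero] at e1 e2 u1 v1 u2 v2
    have uv := mul_le_mul u2 v2 v0 u0
    rw [eq_sub_of_add_eq e1, eq_sub_of_add_eq e2]
    linear_combination u1 + v1 + 2 * uv
  have key (c : F × F) : ∑ s, (∑ η ∈ planeCircle F s, h (c + η) * h (c - η)) ^ 2 ≤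
      (Fintype.card F - 1) * (∑ η, h (c + η) ^ 2 * h (c - η) ^ 2)
        + (2 * ((∑ t, h (c + (t, i * t)) ^ 2) * (∑ t, h (c + (t, -(i * t))) ^ 2))
          - Fintype.card F * h c ^ 4) := by
    calc _ ≤ ∑ s, ((Fintype.card F - 1) *
            (∑ η ∈ planeCircle F s, h (c + η) ^ 2 * h (c - η) ^ 2)
              + if s = 0 then
                (2 * ((∑ t, h (c + (t, i * t)) ^ 2) * (∑ t, h (c + (t, -(i * t))) ^ 2))
                  - Fintype.card F * h c ^ 4) else 0) := by
          refine sum_le_sum fun s _ => ?_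
          split_ifs with hs
          · subst hs
            exact hzero c
          · rw [add_zero]
            refine sq_sum_mul_le _ _ _ ?_
            rw [← hcard]
            exact_mod_cast card_planeCircle_le_sub_one h2 hi hs
      _ = _ := by
          rw [sum_add_distrib, ← mul_sum, sum_sum_planeCircle]
          simp
  refine (sum_le_sum fun c _ => key c).trans_eq ?_
  rw [sum_add_distrib, sum_sub_distrib, ← mul_sum, ← mul_sum, ← mul_sum,
    sum_sum_add_mul_sub h2 fun ξ => h ξ ^ 2,
    sum_isotropic_mul_isotropic h2 hi fun ξ => h ξ ^ 2]
  ring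

theorem sum_sq_sum_planeCircle_le (h2 : (2 : F) ≠ 0) (h : F × F → ℝ) (h0 : ∀ ξ, 0 ≤ h ξ) :
    ∑ c, ∑ s, (∑ η ∈ planeCircle F s, h (c + η) * h (c - η)) ^ 2 ≤
      (Fintype.card F + 1) * (∑ ξ, h ξ ^ 2) ^ 2 - Fintype.card F * ∑ ξ, h ξ ^ 4 := by
  by_cases hs : IsSquare (-1 : F)
  · obtain ⟨i, hi⟩ := hs
    exact sum_sq_sum_planeCircle_le_of_sq_eq h2 (i := i) (by rw [hi, sq]) h h0
  · exact sum_sq_sum_planeCircle_le_of_not_isSquare h2 hs h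

/-- The additive energy of the paraboloid in midpoint coordinates. -/
theorem sum_norm_sq_paraboloid_eq (h2 : (2 : F) ≠ 0) (f : F × F → ℂ) :
    (∑ ξτ : (F × F) × F,
        ‖∑ y ∈ univ.filter (fun y : (F × F) × (F × F) =>
            y.1 + y.2 = ξτ.1 ∧
            (y.1.1 ^ 2 + y.1.2 ^ 2) + (y.2.1 ^ 2 + y.2.2 ^ 2) = ξτ.2),
          f y.1 * f y.2‖ ^ 2) =
      ∑ c, ∑ s, ‖∑ η ∈ planeCircle F s, f (c + η) * f (c - η)‖ ^ 2 := by
  rw [← Fintype.sum_prod_type']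
  symm
  refine Fintype.sum_bijective (fun x : (F × F) × F =>
    (x.1 + x.1, 2 * (x.1.1 ^ 2 + x.1.2 ^ 2) + 2 * x.2)) ?_ _ _ ?_
  · rw [← Finite.injective_iff_bijective]
    rintro ⟨⟨a, b⟩, s⟩ ⟨⟨a', b'⟩, s'⟩ h
    simp only [Prod.mk_add_mk, Prod.mk.injEq] at h ⊢
    obtain ⟨⟨h1, h3⟩, h4⟩ := h
    have ha : a = a' := mul_left_cancel₀ h2 (by linear_combination h1)
    have hb : b = b' := mul_left_cancel₀ h2 (by linear_combination h3)
    subst ha hb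
    exact ⟨⟨rfl, rfl⟩, mul_left_cancel₀ h2 (by linear_combination h4)⟩
  · rintro ⟨⟨a, b⟩, s⟩
    congr 2
    refine sum_nbij' (fun η => ((a, b) + η, (a, b) - η)) (fun y => y.1 - (a, b)) ?_ ?_ ?_ ?_ ?_
    · rintro ⟨x, y⟩ h
      rw [mem_planeCircle] at h
      simp only [mem_filter, mem_univ, true_and, Prod.mk_add_mk, Prod.mk_sub_mk,
        Prod.mk.injEq] at h ⊢
      exact ⟨⟨by ring, by ring⟩, by linear_combination 2 * h⟩
    · rintro ⟨⟨x, y⟩, z, w⟩ h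
      simp only [mem_filter, mem_univ, true_and, Prod.mk_add_mk, Prod.mk.injEq] at h
      obtain ⟨⟨h1, h3⟩, h4⟩ := h
      obtain rfl : z = a + a - x := by linear_combination h1
      obtain rfl : w = b + b - y := by linear_combination h3
      rw [mem_planeCircle]
      exact mul_left_cancel₀ h2 (by simp only [Prod.mk_sub_mk]; linear_combination h4)
    · intro η _
      simp
    · rintro ⟨y, z⟩ h
      simp only [mem_filter, mem_univ, true_and] at h
      have hz : z = (a, b) + (a, b) - y := eq_sub_of_add_eq' h.1
      ext1
      · simp
      · simp only [hz]
        abel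
    · intro η _
      rfl

end Energy

/-- Any maximizer of the sharp L²→L⁴ extension inequality from the paraboloid P² ⊂ F³
has constant modulus. -/
theorem parabola_P2_maximizers_constant_modulus
    (p n q : ℕ) (hp : p.Prime) (hp2 : p ≠ 2) (hn : 0 < n) (hq : q = p ^ n)
    (F : Type) [Field F] [Fintype F] [DecidableEq F] (hF : Fintype.card F = q)
    (f : F × F → ℂ)
    (heq : (∑ ξτ : (F × F) × F,
        ‖∑ y ∈ univ.filter (fun y : (F × F) × (F × F) =>
            y.1 + y.2 = ξτ.1 ∧
            (y.1.1 ^ 2 + y.1.2 ^ 2) + (y.2.1 ^ 2 + y.2.2 ^ 2) = ξτ.2),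
          f y.1 * f y.2‖ ^ 2)
      = ((q : ℝ) + 1 - 1 / q) * (∑ ξ : F × F, ‖f ξ‖ ^ 2) ^ 2) :
    ∃ c : ℝ, 0 ≤ c ∧ ∀ ξ : F × F, ‖f ξ‖ = c := by
  have h2 : (2 : F) ≠ 0 := by
    refine Ring.two_ne_zero fun hchar => ?_
    have := FiniteField.even_card_of_char_two hchar
    have hodd : Odd (p ^ n) := (hp.odd_of_ne_two hp2).pow
    rw [hF, hq] at this
    rw [Nat.odd_iff] at hodd
    omega
  have hqpos : (0 : ℝ) < q := by
    rw [← hF]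
    exact_mod_cast Fintype.card_pos
  have hle : ∑ c, ∑ s, ‖∑ η ∈ planeCircle F s, f (c + η) * f (c - η)‖ ^ 2 ≤
      ∑ c, ∑ s, (∑ η ∈ planeCircle F s, ‖f (c + η)‖ * ‖f (c - η)‖) ^ 2 := by
    gcongr with c _ s _
    exact (norm_sum_le _ _).trans_eq (by simp only [norm_mul])
  rw [← sum_norm_sq_paraboloid_eq h2, heq] at hle
  have hmain := hle.trans (sum_sq_sum_planeCircle_le h2 (fun ξ => ‖f ξ‖) fun ξ => norm_nonneg _)
  rw [hF] at hmain
  set S := ∑ ξ, ‖f ξ‖ ^ 2 with hS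
  set H := ∑ ξ, ‖f ξ‖ ^ 4 with hH
  have hH_le : H ≤ S ^ 2 / q ^ 2 := by
    have : q * H ≤ S ^ 2 / q := by linear_combination hmain
    rw [le_div_iff₀ hqpos] at this
    rw [le_div_iff₀ (by positivity)]
    linear_combination this
  have hcard : (∑ _ξ : F × F, (1 : ℝ)) = q ^ 2 := by
    simp [hF, sq]
  have hvar : ∑ ξ, (‖f ξ‖ ^ 2 - S / q ^ 2) ^ 2 = H - S ^ 2 / q ^ 2 := by
    calc _ = ∑ ξ, (‖f ξ‖ ^ 4 - 2 * (S / q ^ 2) * ‖f ξ‖ ^ 2 + (S / q ^ 2) ^ 2 * 1) :=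
          sum_congr rfl fun ξ _ => by ring
      _ = H - 2 * (S / q ^ 2) * S + (S / q ^ 2) ^ 2 * q ^ 2 := by
          rw [sum_add_distrib, sum_sub_distrib, ← mul_sum, ← mul_sum, hcard]
      _ = _ := by field_simp; ring
  have hzero : ∑ ξ, (‖f ξ‖ ^ 2 - S / q ^ 2) ^ 2 = 0 :=
    le_antisymm (by linarith) (sum_nonneg fun _ _ => sq_nonneg _)
  rw [sum_eq_zero_iff_of_nonneg fun _ _ => sq_nonneg _] at hzero
  refine ⟨√(S / q ^ 2), Real.sqrt_nonneg _, fun ξ => ?_⟩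
  have := sq_eq_zero_iff.1 (hzero ξ (mem_univ ξ))
  rw [← sub_eq_zero.1 this, Real.sqrt_sq (norm_nonneg _)]
end

section
/- Let p be an odd prime, n a positive integer, q = p^n with q ≡ 1 (mod 4), let F be a finite field with exactly q elements, and let w ∈ F satisfy w² = −1. Let Tr : F → ZMod p denote the field trace onto the prime field. A function f : F² → ℂ that is not identically zero attains equality in ∑_{(ξ,τ) ∈ F²×F} | ∑_{ξ₁+ξ₂=ξ, ξ₁·ξ₁+ξ₂·ξ₂=τ} f(ξ₁)f(ξ₂) |² ≤ (q + 1 − 1/q)·(∑_{ξ∈F²}|f(ξ)|²)² if and only if there exist λ ∈ ℂ \ {0} and a, b, c ∈ F such that for all η, ζ ∈ F, f(η·(1,w) + ζ·(1,−w)) = λ · exp(2πi·t/p), where t ∈ {0,…,p−1} is the canonical representative of Tr(aη + bζ + cηζ) ∈ ZMod p. -/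
open Finset

section RectangleEnergy

variable {F : Type*} [Field F] [Fintype F] [DecidableEq F]

/-- The squared `ℓ²` norm of the sums of `G` over the fibers of `φ`, as a sum over pairs. -/
lemma sum_norm_sq_fiber_sum {α β : Type*} [Fintype α] [Fintype β] [DecidableEq β]
    (φ : α → β) (G : α → ℂ) :
    ∑ z, ‖∑ y ∈ univ.filter (fun y => φ y = z), G y‖ ^ 2
      = ∑ y, ∑ y', if φ y = φ y' then (G y * star (G y')).re else 0 := by
  have h (z : β) : ‖∑ y ∈ univ.filter (fun y => φ y = z), G y‖ ^ 2
      = ∑ y, ∑ y', if φ y = z then (if φ y' = z then (G y * star (G y')).re else 0) else 0 := by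
    have h0 (c : ℂ) : ‖c‖ ^ 2 = (c * star c).re := by
      rw [Complex.star_def, Complex.mul_conj, Complex.ofReal_re, Complex.normSq_eq_norm_sq]
    rw [h0, star_sum, sum_mul_sum, Complex.re_sum, sum_filter]
    refine sum_congr rfl fun y _ => ?_
    split_ifs
    · rw [Complex.re_sum, sum_filter]
    · simp
  simp_rw [h]
  rw [sum_comm]
  refine sum_congr rfl fun y _ => ?_
  rw [sum_comm]
  refine sum_congr rfl fun y' _ => ?_
  rw [sum_ite_eq]
  simp [eq_comm]

lemma card_orthogonal (a : F × F) (ha : a ≠ 0) :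
    (univ.filter (fun b : F × F => a.1 * b.1 + a.2 * b.2 = 0)).card = Fintype.card F := by
  have h : univ.filter (fun b : F × F => a.1 * b.1 + a.2 * b.2 = 0)
      = univ.image (fun t : F => (-a.2 * t, a.1 * t)) := by
    ext ⟨b, c⟩
    simp only [mem_filter, mem_univ, true_and, mem_image, Prod.mk.injEq]
    constructor
    · intro hb
      by_cases h1 : a.1 = 0
      · have h2 : a.2 ≠ 0 := fun h2 => ha (Prod.ext h1 h2)
        have hc : c = 0 := by simpa [h1, h2] using hb
        exact ⟨-b / a.2, by field_simp, by simp [h1, hc]⟩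
      · refine ⟨c / a.1, ?_, by field_simp⟩
        field_simp
        linear_combination -hb
    · rintro ⟨t, rfl, rfl⟩
      ring
  rw [h, card_image_of_injective, card_univ]
  intro s t hst
  simp only [Prod.mk.injEq] at hst
  by_cases h1 : a.1 = 0
  · have h2 : a.2 ≠ 0 := fun h2 => ha (Prod.ext h1 h2)
    simpa [h2] using hst.1
  · simpa [h1] using hst.2

/-- The left-hand side of the extension inequality counts rectangles. -/
lemma extension_sum_eq_rectangle_sum (h2 : (2 : F) ≠ 0) (f : F × F → ℂ) :
    ∑ ξτ : (F × F) × F,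
        ‖∑ y ∈ univ.filter (fun y : (F × F) × (F × F) =>
            y.1 + y.2 = ξτ.1 ∧
            (y.1.1 ^ 2 + y.1.2 ^ 2) + (y.2.1 ^ 2 + y.2.2 ^ 2) = ξτ.2),
          f y.1 * f y.2‖ ^ 2
      = ∑ a : F × F, ∑ b ∈ univ.filter (fun b : F × F => a.1 * b.1 + a.2 * b.2 = 0),
          ∑ y, ((f y * star (f (y + a))) * star (f (y + b) * star (f (y + b + a)))).re := by
  let φ : (F × F) × (F × F) → (F × F) × F := fun y =>
    (y.1 + y.2, (y.1.1 ^ 2 + y.1.2 ^ 2) + (y.2.1 ^ 2 + y.2.2 ^ 2))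
  trans ∑ z, ‖∑ y ∈ univ.filter (fun y => φ y = z), f y.1 * f y.2‖ ^ 2
  · refine sum_congr rfl fun z _ => ?_
    congr 2
    refine sum_congr (filter_congr fun y _ => ?_) fun _ _ => rfl
    exact (Prod.ext_iff (x := φ y) (y := z)).symm
  rw [sum_norm_sq_fiber_sum]
  have hR : ∑ a : F × F, ∑ b ∈ univ.filter (fun b : F × F => a.1 * b.1 + a.2 * b.2 = 0),
          ∑ y, ((f y * star (f (y + a))) * star (f (y + b) * star (f (y + b + a)))).re
      = ∑ y, ∑ a : F × F, ∑ b : F × F, if a.1 * b.1 + a.2 * b.2 = 0 then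
          ((f y * star (f (y + a))) * star (f (y + b) * star (f (y + b + a)))).re else 0 := by
    rw [sum_comm (s := univ (α := F × F))]
    refine sum_congr rfl fun a _ => ?_
    rw [sum_filter, sum_comm]
    refine sum_congr rfl fun b _ => ?_
    split_ifs <;> simp
  rw [hR, Fintype.sum_prod_type]
  refine sum_congr rfl fun y _ => ?_
  rw [sum_comm, Fintype.sum_prod_type]
  rw [← Equiv.sum_comp (Equiv.addLeft y)]
  refine sum_congr rfl fun a _ => ?_
  rw [← Equiv.sum_comp (Equiv.addLeft y)]
  refine sum_congr rfl fun b _ => ?_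
  have hφ (x : F × F) : φ (y, x) = φ (y + a, y + b) ↔
      y + b + a = x ∧ a.1 * b.1 + a.2 * b.2 = 0 := by
    simp only [φ, Prod.mk.injEq]
    have h1 : y + x = y + a + (y + b) ↔ y + b + a = x := by
      rw [show y + a + (y + b) = y + (y + b + a) by abel, add_right_inj, eq_comm]
    rw [h1]
    refine and_congr_right ?_
    rintro rfl
    simp only [Prod.fst_add, Prod.snd_add]
    constructor
    · intro h
      apply mul_left_cancel₀ h2
      linear_combination h
    · intro h
      linear_combination 2 * h
  simp only [Equiv.coe_addLeft, hφ, ite_and, sum_ite_eq, mem_univ, if_true]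
  split_ifs
  · simp only [star_mul', star_star]
    congr 1
    ring
  · rfl

/-- The deficit in the rectangle identity. -/
lemma rectangle_sum_eq (f : F × F → ℂ) :
    ∑ a : F × F, ∑ b ∈ univ.filter (fun b : F × F => a.1 * b.1 + a.2 * b.2 = 0),
          ∑ y, ((f y * star (f (y + a))) * star (f (y + b) * star (f (y + b + a)))).re
      = ((Fintype.card F : ℝ) + 1 - 1 / Fintype.card F) * (∑ ξ : F × F, ‖f ξ‖ ^ 2) ^ 2
        - (∑ x : F × F, ∑ y : F × F, (‖f x‖ ^ 2 - ‖f y‖ ^ 2) ^ 2) / (2 * Fintype.card F)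
        - (∑ a ∈ univ.erase (0 : F × F),
            ∑ b ∈ univ.filter (fun b : F × F => a.1 * b.1 + a.2 * b.2 = 0),
            ∑ y, ‖f y * star (f (y + a)) - f (y + b) * star (f (y + b + a))‖ ^ 2) / 2 := by
  set q : ℝ := (Fintype.card F : ℝ) with hq
  have hq0 : q ≠ 0 := by simp [hq]
  set N := ∑ ξ : F × F, ‖f ξ‖ ^ 2 with hN
  set M := ∑ ξ : F × F, ‖f ξ‖ ^ 4 with hM
  have hV : ∑ x : F × F, ∑ y : F × F, (‖f x‖ ^ 2 - ‖f y‖ ^ 2) ^ 2 = 2 * q ^ 2 * M - 2 * N ^ 2 := by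
    have h (x y : F × F) : (‖f x‖ ^ 2 - ‖f y‖ ^ 2) ^ 2
        = ‖f x‖ ^ 4 + ‖f y‖ ^ 4 - 2 * (‖f x‖ ^ 2 * ‖f y‖ ^ 2) := by ring
    simp_rw [h, sum_sub_distrib, sum_add_distrib, ← mul_sum, ← sum_mul]
    simp only [sum_const, card_univ, Fintype.card_prod, nsmul_eq_mul, ← hN, ← hM, Nat.cast_mul,
      ← hq, ← mul_sum]
    ring
  have shift (H : F × F → ℝ) (b : F × F) : ∑ y, H (y + b) = ∑ y, H y :=
    Equiv.sum_comp (Equiv.addRight b) H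
  have shift' (H : F × F → ℝ) (b : F × F) : ∑ y, H (b + y) = ∑ y, H y :=
    Equiv.sum_comp (Equiv.addLeft b) H
  have hX : ∑ a : F × F, ∑ y, ‖f y * star (f (y + a))‖ ^ 2 = N ^ 2 := by
    rw [sum_comm]
    simp_rw [norm_mul, norm_star, mul_pow, ← mul_sum]
    rw [sq, hN, sum_mul]
    refine sum_congr rfl fun y _ => ?_
    rw [shift' (fun z => ‖f z‖ ^ 2)]
  have hX0 : ∑ y, ‖f y * star (f (y + 0))‖ ^ 2 = M :=
    sum_congr rfl fun y _ => by rw [norm_mul, norm_star, add_zero]; ring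
  have h0 : ∑ b ∈ univ.filter (fun b : F × F => (0 : F × F).1 * b.1 + (0 : F × F).2 * b.2 = 0),
      ∑ y, ((f y * star (f (y + 0))) * star (f (y + b) * star (f (y + b + 0)))).re = N ^ 2 := by
    rw [← hX]
    simp only [Prod.fst_zero, Prod.snd_zero, zero_mul, add_zero, filter_true]
    refine sum_congr rfl fun b _ => sum_congr rfl fun y _ => ?_
    simp only [Complex.star_def, map_mul, Complex.conj_conj]
    rw [norm_mul, mul_pow, ← Complex.normSq_eq_norm_sq, RCLike.norm_conj,
      ← Complex.normSq_eq_norm_sq, Complex.mul_conj, mul_comm (starRingEnd ℂ _), Complex.mul_conj,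
      ← Complex.ofReal_mul, Complex.ofReal_re]
  have h1 (a : F × F) (ha : a ≠ 0) :
      ∑ b ∈ univ.filter (fun b : F × F => a.1 * b.1 + a.2 * b.2 = 0),
          ∑ y, ((f y * star (f (y + a))) * star (f (y + b) * star (f (y + b + a)))).re
        = q * ∑ y, ‖f y * star (f (y + a))‖ ^ 2
          - (∑ b ∈ univ.filter (fun b : F × F => a.1 * b.1 + a.2 * b.2 = 0),
            ∑ y, ‖f y * star (f (y + a)) - f (y + b) * star (f (y + b + a))‖ ^ 2) / 2 := by
    have h (b : F × F) :
        ∑ y, ((f y * star (f (y + a))) * star (f (y + b) * star (f (y + b + a)))).re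
          = ∑ y, ‖f y * star (f (y + a))‖ ^ 2
            - (∑ y, ‖f y * star (f (y + a)) - f (y + b) * star (f (y + b + a))‖ ^ 2) / 2 := by
      have hs (z v : ℂ) : ‖z - v‖ ^ 2 = ‖z‖ ^ 2 + ‖v‖ ^ 2 - 2 * (z * star v).re := by
        simp only [← Complex.normSq_eq_norm_sq, Complex.normSq_sub, Complex.star_def]
      simp_rw [hs, sum_sub_distrib, sum_add_distrib, ← mul_sum]
      rw [shift (fun z => ‖f z * star (f (z + a))‖ ^ 2)]
      ring
    simp_rw [h, sum_sub_distrib, sum_const, card_orthogonal a ha, sum_div, nsmul_eq_mul, ← hq]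
  rw [hV, ← add_sum_erase univ _ (mem_univ (0 : F × F)), h0,
    sum_congr rfl fun a ha => h1 a (ne_of_mem_erase ha), sum_sub_distrib, ← mul_sum, ← sum_div]
  rw [← add_sum_erase univ _ (mem_univ (0 : F × F)), hX0] at hX
  rw [eq_sub_of_add_eq' hX]
  field_simp
  ring

/-- Equality holds exactly for functions of constant modulus that are multiplicatively
additive on rectangles. -/
lemma extension_eq_iff (h2 : (2 : F) ≠ 0) (f : F × F → ℂ) :
    (∑ ξτ : (F × F) × F,
        ‖∑ y ∈ univ.filter (fun y : (F × F) × (F × F) =>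
            y.1 + y.2 = ξτ.1 ∧
            (y.1.1 ^ 2 + y.1.2 ^ 2) + (y.2.1 ^ 2 + y.2.2 ^ 2) = ξτ.2),
          f y.1 * f y.2‖ ^ 2
      = ((Fintype.card F : ℝ) + 1 - 1 / Fintype.card F) * (∑ ξ : F × F, ‖f ξ‖ ^ 2) ^ 2)
    ↔ (∀ x y, ‖f x‖ = ‖f y‖) ∧ ∀ a b y : F × F, a.1 * b.1 + a.2 * b.2 = 0 →
        f y * f (y + a + b) = f (y + a) * f (y + b) := by
  rw [extension_sum_eq_rectangle_sum h2, rectangle_sum_eq]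
  have hq : (0 : ℝ) < Fintype.card F := by exact_mod_cast Fintype.card_pos
  have hV : 0 ≤ ∑ x : F × F, ∑ y : F × F, (‖f x‖ ^ 2 - ‖f y‖ ^ 2) ^ 2 := by positivity
  have hD : 0 ≤ ∑ a ∈ univ.erase (0 : F × F),
            ∑ b ∈ univ.filter (fun b : F × F => a.1 * b.1 + a.2 * b.2 = 0),
            ∑ y, ‖f y * star (f (y + a)) - f (y + b) * star (f (y + b + a))‖ ^ 2 := by positivity
  have key (V D A q : ℝ) (hV : 0 ≤ V) (hD : 0 ≤ D) (hq : 0 < q) :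
      A - V / (2 * q) - D / 2 = A ↔ V = 0 ∧ D = 0 := by
    constructor
    · intro h
      have : 0 ≤ V / (2 * q) := by positivity
      have hD0 : D = 0 := by linarith
      have hV0 : V / (2 * q) = 0 := by linarith
      refine ⟨?_, hD0⟩
      simpa [hq.ne'] using hV0
    · rintro ⟨rfl, rfl⟩
      simp
  rw [key _ _ _ _ hV hD hq]
  have hVi : (∑ x : F × F, ∑ y : F × F, (‖f x‖ ^ 2 - ‖f y‖ ^ 2) ^ 2) = 0 ↔
      ∀ x y, ‖f x‖ = ‖f y‖ := by
    rw [sum_eq_zero_iff_of_nonneg fun _ _ => by positivity]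
    refine ⟨fun h x y => ?_, fun h x _ => sum_eq_zero fun y _ => by rw [h x y]; ring⟩
    have h3 := (sum_eq_zero_iff_of_nonneg fun _ _ => by positivity).1 (h x (mem_univ _)) y
      (mem_univ _)
    exact (pow_left_inj₀ (norm_nonneg _) (norm_nonneg _) two_ne_zero).1
      (sub_eq_zero.1 (pow_eq_zero_iff two_ne_zero |>.1 h3))
  have hDi : (∑ a ∈ univ.erase (0 : F × F),
            ∑ b ∈ univ.filter (fun b : F × F => a.1 * b.1 + a.2 * b.2 = 0),
            ∑ y, ‖f y * star (f (y + a)) - f (y + b) * star (f (y + b + a))‖ ^ 2) = 0 ↔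
      ∀ a ≠ 0, ∀ b : F × F, a.1 * b.1 + a.2 * b.2 = 0 → ∀ y,
        f y * star (f (y + a)) = f (y + b) * star (f (y + b + a)) := by
    constructor
    · intro h a ha b hb y
      have h3 := (sum_eq_zero_iff_of_nonneg fun _ _ => by positivity).1 h a (by simp [ha])
      have h4 := (sum_eq_zero_iff_of_nonneg fun _ _ => by positivity).1 h3 b (by simp [hb])
      have h5 := (sum_eq_zero_iff_of_nonneg fun _ _ => by positivity).1 h4 y (mem_univ _)
      exact sub_eq_zero.1 (norm_eq_zero.1 (pow_eq_zero_iff two_ne_zero |>.1 h5))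
    · intro h
      refine sum_eq_zero fun a ha => sum_eq_zero fun b hb => sum_eq_zero fun y _ => ?_
      rw [h a (ne_of_mem_erase ha) b (mem_filter.1 hb).2 y]
      simp
  rw [hVi, hDi]
  refine and_congr_right fun hc => ?_
  by_cases hz : f 0 = 0
  · have : ∀ x, f x = 0 := fun x => by rw [← norm_eq_zero, hc x 0, hz, norm_zero]
    simp [this]
  have hne (x) : f x ≠ 0 := by rw [← norm_ne_zero_iff, hc x 0, norm_ne_zero_iff]; exact hz
  have hsq (x) : f x * star (f x) = f 0 * star (f 0) := by
    simp only [Complex.star_def, Complex.mul_conj, Complex.normSq_eq_norm_sq, hc x 0]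
  have hsne (x) : star (f x) ≠ 0 := by simpa using hne x
  have hiff (a b y : F × F) : f y * star (f (y + a)) = f (y + b) * star (f (y + b + a)) ↔
      f y * f (y + a + b) = f (y + a) * f (y + b) := by
    rw [add_right_comm y b a]
    constructor
    · intro h
      apply mul_right_cancel₀ (hsne (y + a))
      linear_combination f (y + a + b) * h + f (y + b) * (hsq (y + a + b) - hsq (y + a))
    · intro h
      apply mul_right_cancel₀ (hne (y + a + b))
      linear_combination star (f (y + a)) * h + f (y + b) * (hsq (y + a) - hsq (y + a + b))
  simp_rw [hiff]
  refine ⟨fun h a b y hab => ?_, fun h a _ b hab y => h a b y hab⟩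
  rcases eq_or_ne a 0 with rfl | ha
  · simp
  · exact h a ha b hab y

end RectangleEnergy

section Characters

/-- A nowhere vanishing function on `F × F` which is multiplicatively additive on rectangles
of the hyperbolic form is a quadratic character. -/
lemma exists_addChar_of_hyperbolic_rectangles {F : Type*} [Field F] (h : F → F → ℂ)
    (h0 : h 0 0 = 1) (hne : ∀ x y, h x y ≠ 0)
    (hr : ∀ x y s t s' t', s * t' + t * s' = 0 →
      h x y * h (x + s + s') (y + t + t') = h (x + s) (y + t) * h (x + s') (y + t')) :
    ∃ χ₁ χ₂ χ₃ : AddChar F ℂ, ∀ x y, h x y = χ₁ x * χ₂ y * χ₃ (x * y) := by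
  have hx (x x' y) : h 0 y * h (x + x') y = h x y * h x' y := by
    simpa using hr 0 y x 0 x' 0 (by simp)
  have hy (x y y') : h x 0 * h x (y + y') = h x y * h x y' := by
    simpa using hr x 0 0 y 0 y' (by simp)
  have hx0 (x x') : h (x + x') 0 = h x 0 * h x' 0 := by simpa [h0] using hx x x' 0
  have hy0 (y y') : h 0 (y + y') = h 0 y * h 0 y' := by simpa [h0] using hy 0 y y'
  obtain ⟨k, hk⟩ : ∃ k : F → F → ℂ, ∀ x y, h x y = h x 0 * h 0 y * k x y :=
    ⟨fun x y => h x y / (h x 0 * h 0 y), fun x y => by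
      have := hne x 0
      have := hne 0 y
      field_simp⟩
  have hkne (x y) : k x y ≠ 0 := fun h' => hne x y (by rw [hk, h', mul_zero])
  have hkx (x x' y) : k (x + x') y = k x y * k x' y := by
    have h1 := hx x x' y
    rw [hk (x + x') y, hk x y, hk x' y, hx0] at h1
    apply mul_left_cancel₀ (a := h 0 y * h 0 y * h x 0 * h x' 0) (by simp [hne])
    linear_combination h1
  have hky (x y y') : k x (y + y') = k x y * k x y' := by
    have h1 := hy x y y'
    rw [hk x (y + y'), hk x y, hk x y', hy0] at h1
    apply mul_left_cancel₀ (a := h x 0 * h x 0 * h 0 y * h 0 y') (by simp [hne])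
    linear_combination h1
  have hk0 (x) : k x 0 = 1 := by
    have := hk x 0
    rw [h0, mul_one] at this
    exact mul_left_cancel₀ (hne x 0) (by rw [← this, mul_one])
  have hk0' (y) : k 0 y = 1 := by
    have := hk 0 y
    rw [h0, one_mul] at this
    exact mul_left_cancel₀ (hne 0 y) (by rw [← this, mul_one])
  have hsym (x y) : k x y = k (x * y) 1 := by
    have h1 := hr 0 0 x 1 (x * y) (-y) (by ring)
    simp only [zero_add, h0, one_mul] at h1
    rw [hk (x + x * y), hk x 1, hk (x * y) (-y), hx0, hy0, hkx, hky, hky] at h1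
    have h3 : k x y * k x (-y) = 1 := by rw [← hky, add_neg_cancel, hk0]
    have h4 : k x (-y) * k (x * y) 1 = 1 := by
      apply mul_left_cancel₀ (a := h x 0 * h (x * y) 0 * h 0 1 * h 0 (-y) * k x 1 * k (x * y) (-y))
        (by simp [hne, hkne])
      linear_combination h1
    exact mul_right_cancel₀ (hkne x (-y)) (by rw [h3, mul_comm, h4])
  refine ⟨⟨fun x => h x 0, h0, hx0⟩, ⟨fun y => h 0 y, h0, hy0⟩,
    ⟨fun x => k x 1, hk0' 1, fun x x' => hkx x x' 1⟩, fun x y => ?_⟩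
  change h x y = h x 0 * h 0 y * k (x * y) 1
  rw [hk, hsym]

/-- The standard additive character `x ↦ exp (2πi Tr x / p)` of a finite field. -/
noncomputable def stdTraceChar (p : ℕ) [NeZero p] (F : Type*) [Field F] [Algebra (ZMod p) F] :
    AddChar F ℂ :=
  (ZMod.stdAddChar (N := p)).compAddMonoidHom (Algebra.trace (ZMod p) F).toAddMonoidHom

lemma stdTraceChar_apply (p : ℕ) [NeZero p] {F : Type*} [Field F] [Algebra (ZMod p) F] (x : F) :
    stdTraceChar p F x = Complex.exp (2 * (Real.pi : ℂ) * Complex.I *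
      ((Algebra.trace (ZMod p) F x).val : ℂ) / (p : ℂ)) := by
  change ZMod.stdAddChar (Algebra.trace (ZMod p) F x) = _
  have h := ZMod.stdAddChar_coe (N := p) ((Algebra.trace (ZMod p) F x).val : ℤ)
  simpa using h

lemma exists_stdTraceChar_mul (p : ℕ) [Fact p.Prime] {F : Type*} [Field F] [Finite F]
    [Algebra (ZMod p) F] (χ : AddChar F ℂ) : ∃ a, ∀ x, χ x = stdTraceChar p F (a * x) := by
  have := Fintype.ofFinite F
  have hprim : (stdTraceChar p F).IsPrimitive := by
    apply AddChar.IsPrimitive.of_ne_one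
    obtain ⟨a, ha⟩ := Algebra.trace_surjective (ZMod p) F 1
    refine AddChar.ne_one_iff.2 ⟨a, fun h => one_ne_zero (α := ZMod p) ?_⟩
    apply ZMod.injective_stdAddChar
    rw [← ha, AddChar.map_zero_eq_one]
    exact h
  have hbij : Function.Bijective (AddChar.mulShift (stdTraceChar p F)) := by
    rw [Fintype.bijective_iff_injective_and_card]
    exact ⟨AddChar.to_mulShift_inj_of_isPrimitive hprim, AddChar.card_eq.symm⟩
  obtain ⟨a, rfl⟩ := hbij.2 χ
  exact ⟨a, fun x => AddChar.mulShift_apply⟩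

end Characters

/-- Full characterization of the maximizers of the sharp L²→L⁴ extension inequality
from the paraboloid P² ⊂ F³ when q ≡ 1 (mod 4). -/
theorem parabola_P2_maximizers_characterization
    (p n q : ℕ) (hp : p.Prime) (hp2 : p ≠ 2) (hn : 0 < n) (hq : q = p ^ n)
    (hq4 : q % 4 = 1)
    (F : Type) [Field F] [Fintype F] [DecidableEq F] [Algebra (ZMod p) F]
    (hF : Fintype.card F = q)
    (w : F) (hw : w ^ 2 = -1)
    (f : F × F → ℂ) (hf : f ≠ 0) :
    ((∑ ξτ : (F × F) × F,
        ‖∑ y ∈ univ.filter (fun y : (F × F) × (F × F) =>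
            y.1 + y.2 = ξτ.1 ∧
            (y.1.1 ^ 2 + y.1.2 ^ 2) + (y.2.1 ^ 2 + y.2.2 ^ 2) = ξτ.2),
          f y.1 * f y.2‖ ^ 2)
      = ((q : ℝ) + 1 - 1 / q) * (∑ ξ : F × F, ‖f ξ‖ ^ 2) ^ 2)
    ↔ ∃ (lam : ℂ) (a b c : F), lam ≠ 0 ∧ ∀ η ζ : F,
        f (η + ζ, (η - ζ) * w)
          = lam * Complex.exp (2 * (Real.pi : ℂ) * Complex.I *
              ((Algebra.trace (ZMod p) F (a * η + b * ζ + c * η * ζ)).val : ℂ) / (p : ℂ)) := by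
  have : Fact p.Prime := ⟨hp⟩
  have h2 : (2 : F) ≠ 0 := by
    intro h
    have h3 : algebraMap (ZMod p) F ((2 : ℕ) : ZMod p) = 0 := by
      rw [map_natCast]
      exact_mod_cast h
    rw [map_eq_zero, ZMod.natCast_eq_zero_iff] at h3
    exact hp2 ((Nat.prime_dvd_prime_iff_eq hp Nat.prime_two).1 h3)
  have hw0 : w ≠ 0 := by
    rintro rfl
    simp at hw
  simp_rw [← stdTraceChar_apply]
  rw [← hF, extension_eq_iff h2 f]
  constructor
  · rintro ⟨hc, hr⟩
    have hne (x) : f x ≠ 0 := fun hx => hf <| funext fun y => by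
      exact norm_eq_zero.1 (by rw [hc y x, hx, norm_zero])
    obtain ⟨χ₁, χ₂, χ₃, hχ⟩ := exists_addChar_of_hyperbolic_rectangles
      (fun η ζ => f (η + ζ, (η - ζ) * w) / f 0) (by simp [hne, ← Prod.zero_eq_mk])
      (fun x y => div_ne_zero (hne _) (hne _)) (fun x y s t s' t' h => by
        have h1 := hr (s + t, (s - t) * w) (s' + t', (s' - t') * w) (x + y, (x - y) * w)
          (by linear_combination 2 * h + (s - t) * (s' - t') * hw)
        have e1 : ((x + y, (x - y) * w) + (s + t, (s - t) * w) + (s' + t', (s' - t') * w) : F × F)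
            = (x + s + s' + (y + t + t'), (x + s + s' - (y + t + t')) * w) := by
          ext <;> simp <;> ring
        have e2 : ((x + y, (x - y) * w) + (s + t, (s - t) * w) : F × F)
            = (x + s + (y + t), (x + s - (y + t)) * w) := by
          ext <;> simp <;> ring
        have e3 : ((x + y, (x - y) * w) + (s' + t', (s' - t') * w) : F × F)
            = (x + s' + (y + t'), (x + s' - (y + t')) * w) := by
          ext <;> simp <;> ring
        rw [e1, e2, e3] at h1
        rw [div_mul_div_comm, div_mul_div_comm, h1])
    obtain ⟨a, ha⟩ := exists_stdTraceChar_mul p χ₁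
    obtain ⟨b, hb⟩ := exists_stdTraceChar_mul p χ₂
    obtain ⟨c, hc⟩ := exists_stdTraceChar_mul p χ₃
    refine ⟨f 0, a, b, c, hne 0, fun η ζ => ?_⟩
    rw [mul_assoc c, AddChar.map_add_eq_mul, AddChar.map_add_eq_mul, ← ha, ← hb, ← hc, ← hχ,
      mul_div_cancel₀ _ (hne 0)]
  · rintro ⟨lam, a, b, c, -, hl⟩
    obtain ⟨H, hH⟩ : ∃ H : F × F → F, ∀ x, H x = a * ((x.1 - x.2 * w) / 2)
        + b * ((x.1 + x.2 * w) / 2) + c * ((x.1 - x.2 * w) / 2) * ((x.1 + x.2 * w) / 2) :=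
      ⟨_, fun _ => rfl⟩
    have hfx (x : F × F) : f x = lam * stdTraceChar p F (H x) := by
      rw [hH, ← hl]
      congr 1
      ext
      · simp only
        field_simp
        ring
      · simp only
        field_simp
        linear_combination 2 * x.2 * hw
    refine ⟨fun x y => by simp [hfx], fun s t y h => ?_⟩
    have hsum : H y + H (y + s + t) = H (y + s) + H (y + t) := by
      simp only [hH, Prod.fst_add, Prod.snd_add]
      field_simp
      linear_combination 2 * c * h - 2 * c * s.2 * t.2 * hw
    simp only [hfx]
    rw [mul_mul_mul_comm, mul_mul_mul_comm lam _ lam, ← AddChar.map_add_eq_mul,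
      ← AddChar.map_add_eq_mul, hsum]
end

section
/- Let p be a prime with p > 3, n a positive integer, q = p^n, and let F be a finite field with exactly q elements. For every function f : F → ℂ one has ∑_{(ξ,τ) ∈ F×F} | ∑_{(ξ₁,ξ₂,ξ₃) ∈ F³ with ξ₁+ξ₂+ξ₃=ξ and ξ₁²+ξ₂²+ξ₃²=τ} f(ξ₁)f(ξ₂)f(ξ₃) |² ≤ (q + 1 − 1/q) · ( ∑_{ξ ∈ F} |f(ξ)|² )³, and equality holds whenever f is a constant function. (This is the combinatorial form of the sharp L²→L⁶ extension inequality from the parabola P¹ ⊂ F², with best constant R*_{P¹}(2→6) = (1 + q⁻¹ − q⁻²)^{1/6}.) -/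
open Finset

section ParabolaTriples

variable {F : Type*} [Field F] [Fintype F] [DecidableEq F]

/-- Triples of points of the parabola over `F` adding up to `(ξ, τ)`. -/
def parabolaTriples (ξτ : F × F) : Finset (F × F × F) :=
  univ.filter (fun y : F × F × F =>
    y.1 + y.2.1 + y.2.2 = ξτ.1 ∧ y.1 ^ 2 + y.2.1 ^ 2 + y.2.2 ^ 2 = ξτ.2)

theorem mem_parabolaTriples {ξτ : F × F} {y : F × F × F} :
    y ∈ parabolaTriples ξτ ↔
      y.1 + y.2.1 + y.2.2 = ξτ.1 ∧ y.1 ^ 2 + y.2.1 ^ 2 + y.2.2 ^ 2 = ξτ.2 := by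
  simp [parabolaTriples]

theorem sum_sum_parabolaTriples (H : F × F × F → ℝ) :
    ∑ ξτ : F × F, ∑ y ∈ parabolaTriples ξτ, H y = ∑ y, H y := by
  rw [← Finset.sum_fiberwise univ
    (fun y : F × F × F => (y.1 + y.2.1 + y.2.2, y.1 ^ 2 + y.2.1 ^ 2 + y.2.2 ^ 2)) H]
  refine sum_congr rfl fun ξτ _ => sum_congr ?_ fun _ _ => rfl
  ext y
  simp [mem_parabolaTriples, Prod.ext_iff]

/-- The points `(ξ, τ)` with `3 τ = ξ ^ 2` are exactly the points `(3 a, 3 a ^ 2)`. -/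
theorem sum_ite_three_mul_eq_sq (h3 : (3 : F) ≠ 0) (φ : F × F → ℝ) :
    ∑ ξτ : F × F, (if 3 * ξτ.2 = ξτ.1 ^ 2 then φ ξτ else 0) = ∑ a : F, φ (3 * a, 3 * a ^ 2) := by
  rw [← sum_filter]
  symm
  refine sum_bij (fun a _ => (3 * a, 3 * a ^ 2)) ?_ ?_ ?_ ?_
  · intro a _
    simp only [mem_filter, mem_univ, true_and]
    ring
  · intro a _ b _ h
    exact mul_left_cancel₀ h3 (Prod.ext_iff.1 h).1
  · rintro ⟨ξ, τ⟩ h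
    simp only [mem_filter, mem_univ, true_and] at h
    refine ⟨ξ / 3, mem_univ _, ?_⟩
    ext
    · field_simp
    · field_simp
      exact h.symm
  · intros
    rfl

theorem sum_sq_parabolaTriples_le (h3 : (3 : F) ≠ 0) (M : ℝ)
    (hM : ∀ ξτ : F × F, 3 * ξτ.2 ≠ ξτ.1 ^ 2 → ((parabolaTriples ξτ).card : ℝ) ≤ M)
    (P : F × F × F → ℝ) :
    ∑ ξτ : F × F, (∑ y ∈ parabolaTriples ξτ, P y) ^ 2 ≤ M * ∑ y, P y ^ 2 +
      ∑ a : F, ((∑ y ∈ parabolaTriples (3 * a, 3 * a ^ 2), P y) ^ 2 -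
        M * ∑ y ∈ parabolaTriples (3 * a, 3 * a ^ 2), P y ^ 2) := by
  rw [← sum_ite_three_mul_eq_sq h3 (fun ξτ => (∑ y ∈ parabolaTriples ξτ, P y) ^ 2 -
        M * ∑ y ∈ parabolaTriples ξτ, P y ^ 2), ← sum_sum_parabolaTriples, mul_sum,
    ← sum_add_distrib]
  refine sum_le_sum fun ξτ _ => ?_
  split_ifs with h
  · simp
  · rw [add_zero]
    refine sq_sum_le_card_mul_sum_sq.trans ?_
    exact mul_le_mul_of_nonneg_right (hM ξτ h) (sum_nonneg fun _ _ => sq_nonneg _)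

theorem le_sum_card_sq_parabolaTriples (h3 : (3 : F) ≠ 0) (M : ℝ) :
    2 * M * (Fintype.card F : ℝ) ^ 3 - M ^ 2 * (Fintype.card F : ℝ) ^ 2 +
      ∑ a : F, (((parabolaTriples (3 * a, 3 * a ^ 2)).card : ℝ) - M) ^ 2 ≤
    ∑ ξτ : F × F, ((parabolaTriples ξτ).card : ℝ) ^ 2 := by
  have hN : ∑ ξτ : F × F, ((parabolaTriples ξτ).card : ℝ) = (Fintype.card F : ℝ) ^ 3 := by
    have h := sum_sum_parabolaTriples (F := F) (fun _ => 1)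
    simp only [sum_const, nsmul_eq_mul, mul_one, card_univ, Fintype.card_prod] at h
    rw [h]
    push_cast
    ring
  have h1 : ∑ _ξτ : F × F, M ^ 2 = M ^ 2 * (Fintype.card F : ℝ) ^ 2 := by
    simp only [sum_const, nsmul_eq_mul, card_univ, Fintype.card_prod]
    push_cast
    ring
  rw [← sum_ite_three_mul_eq_sq h3 (fun ξτ => (((parabolaTriples ξτ).card : ℝ) - M) ^ 2), ← hN,
    ← h1, mul_sum, ← sum_sub_distrib, ← sum_add_distrib]
  refine sum_le_sum fun ξτ _ => ?_
  split_ifs with h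
  · linarith
  · nlinarith [sq_nonneg (((parabolaTriples ξτ).card : ℝ) - M)]

end ParabolaTriples

section Split

variable {F : Type*} [Field F] {ω : F}

theorem two_mul_mul_eq_of_cube_root (hω : ω ^ 2 + ω + 1 = 0) (x y z : F) :
    2 * ((x + ω * y + ω ^ 2 * z) * (x + ω ^ 2 * y + ω * z)) =
      3 * (x ^ 2 + y ^ 2 + z ^ 2) - (x + y + z) ^ 2 := by
  linear_combination (2 * ((ω - 1) * (y ^ 2 + z ^ 2) + x * y + x * z +
    (ω ^ 2 - ω + 1) * (y * z))) * hω

theorem cube_root_sub_sq_ne_zero (h3 : (3 : F) ≠ 0) (hω : ω ^ 2 + ω + 1 = 0) :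
    ω - ω ^ 2 ≠ 0 := by
  intro h
  apply h3
  linear_combination (3 - 2 * ω) * hω - (2 * ω + 1) * h

/-- A triple is determined by its discrete Fourier transform. -/
theorem triple_ext_of_cube_root (h3 : (3 : F) ≠ 0) (hω : ω ^ 2 + ω + 1 = 0) {x y z x' y' z' : F}
    (hs : x + y + z = x' + y' + z')
    (hu : x + ω * y + ω ^ 2 * z = x' + ω * y' + ω ^ 2 * z')
    (hv : x + ω ^ 2 * y + ω * z = x' + ω ^ 2 * y' + ω * z') :
    (x, y, z) = (x', y', z') := by
  have hω3 : ω ^ 3 = 1 := by linear_combination (ω - 1) * hω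
  have hω4 : ω ^ 4 = ω := by linear_combination ω * hω3
  ext
  · refine mul_left_cancel₀ h3 ?_
    linear_combination hs + hu + hv - (y + z - y' - z') * hω
  · refine mul_left_cancel₀ h3 ?_
    linear_combination hs + ω ^ 2 * hu + ω * hv - (x - x') * hω - 2 * (y - y') * hω3 -
      (z - z') * (hω4 + hω)
  · refine mul_left_cancel₀ h3 ?_
    linear_combination hs + ω * hu + ω ^ 2 * hv - (x - x') * hω - 2 * (z - z') * hω3 -
      (y - y') * (hω4 + hω)

variable [Fintype F] [DecidableEq F]

theorem card_parabolaTriples_le_of_cube_root (h2 : (2 : F) ≠ 0) (h3 : (3 : F) ≠ 0)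
    (hω : ω ^ 2 + ω + 1 = 0) {ξτ : F × F} (h : 3 * ξτ.2 ≠ ξτ.1 ^ 2) :
    ((parabolaTriples ξτ).card : ℝ) ≤ (Fintype.card F : ℝ) - 1 := by
  have key : ∀ y ∈ parabolaTriples ξτ,
      2 * ((y.1 + ω * y.2.1 + ω ^ 2 * y.2.2) * (y.1 + ω ^ 2 * y.2.1 + ω * y.2.2)) =
        3 * ξτ.2 - ξτ.1 ^ 2 := by
    intro y hy
    rw [mem_parabolaTriples] at hy
    rw [two_mul_mul_eq_of_cube_root hω, hy.1, hy.2]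
  have hc : 3 * ξτ.2 - ξτ.1 ^ 2 ≠ 0 := sub_ne_zero.2 h
  have hu : ∀ y ∈ parabolaTriples ξτ, y.1 + ω * y.2.1 + ω ^ 2 * y.2.2 ≠ 0 := by
    intro y hy h0
    have := key y hy
    rw [h0] at this
    exact hc (by linear_combination -this)
  have hle : (parabolaTriples ξτ).card ≤ ((univ : Finset F).erase 0).card := by
    refine card_le_card_of_injOn (fun y => y.1 + ω * y.2.1 + ω ^ 2 * y.2.2) ?_ ?_
    · intro y hy
      simpa using hu y hy
    · intro y hy y' hy' huu
      have e := (key y hy).trans (key y' hy').symm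
      have hs := ((mem_parabolaTriples.1 hy).1).trans ((mem_parabolaTriples.1 hy').1).symm
      dsimp only at huu
      rw [huu] at e
      exact triple_ext_of_cube_root h3 hω hs huu
        (mul_left_cancel₀ (hu y' hy') (mul_left_cancel₀ h2 e))
  rw [card_erase_of_mem (mem_univ _), card_univ] at hle
  have h1 : 1 ≤ Fintype.card F := Fintype.card_pos
  calc ((parabolaTriples ξτ).card : ℝ) ≤ ((Fintype.card F - 1 : ℕ) : ℝ) := by exact_mod_cast hle
    _ = _ := by push_cast [h1]; ring

/-- Over `(3 a, 3 a ^ 2)` the triples form two lines meeting in `(a, a, a)`. -/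
theorem sum_parabolaTriples_of_cube_root (h2 : (2 : F) ≠ 0) (h3 : (3 : F) ≠ 0)
    (hω : ω ^ 2 + ω + 1 = 0) (a : F) (H : F × F × F → ℝ) :
    ∑ y ∈ parabolaTriples (3 * a, 3 * a ^ 2), H y =
      ∑ t, H (a + t, a + ω * t, a + ω ^ 2 * t) + ∑ t, H (a + t, a + ω ^ 2 * t, a + ω * t) -
        H (a, a, a) := by
  have hω3 : ω ^ 3 = 1 := by linear_combination (ω - 1) * hω
  have hω4 : ω ^ 4 = ω := by linear_combination ω * hω3
  have inj1 : Function.Injective fun t : F => (a + t, a + ω * t, a + ω ^ 2 * t) :=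
    fun t s h => add_left_cancel (Prod.ext_iff.1 h).1
  have inj2 : Function.Injective fun t : F => (a + t, a + ω ^ 2 * t, a + ω * t) :=
    fun t s h => add_left_cancel (Prod.ext_iff.1 h).1
  have hunion : parabolaTriples (3 * a, 3 * a ^ 2) =
      univ.image (fun t : F => (a + t, a + ω * t, a + ω ^ 2 * t)) ∪
      univ.image (fun t : F => (a + t, a + ω ^ 2 * t, a + ω * t)) := by
    ext ⟨x, y, z⟩
    simp only [mem_parabolaTriples, mem_union, mem_image, mem_univ, true_and]
    constructor
    · rintro ⟨hs, hq⟩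
      have e := two_mul_mul_eq_of_cube_root hω x y z
      rw [hs, hq] at e
      have e0 : (x + ω * y + ω ^ 2 * z) * (x + ω ^ 2 * y + ω * z) = 0 := by
        refine mul_left_cancel₀ h2 ?_
        linear_combination e
      rcases mul_eq_zero.1 e0 with hu | hv
      · left
        refine ⟨x - a, triple_ext_of_cube_root h3 hω ?_ ?_ ?_⟩
        · linear_combination (x - a) * hω - hs
        · linear_combination a * hω + (x - a) * (hω4 + hω) - hu
        · linear_combination (a - y - z) * hω + 2 * (x - a) * hω3 + hs + hu
      · right
        refine ⟨x - a, triple_ext_of_cube_root h3 hω ?_ ?_ ?_⟩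
        · linear_combination (x - a) * hω - hs
        · linear_combination (a - y - z) * hω + 2 * (x - a) * hω3 + hs + hv
        · linear_combination a * hω + (x - a) * (hω4 + hω) - hv
    · rintro (⟨t, ht⟩ | ⟨t, ht⟩) <;> simp only [Prod.mk.injEq] at ht <;>
        obtain ⟨rfl, rfl, rfl⟩ := ht <;> constructor
      · linear_combination t * hω
      · linear_combination (2 * a * t) * hω + t ^ 2 * (hω4 + hω)
      · linear_combination t * hω
      · linear_combination (2 * a * t) * hω + t ^ 2 * (hω4 + hω)
  have hinter : univ.image (fun t : F => (a + t, a + ω * t, a + ω ^ 2 * t)) ∩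
      univ.image (fun t : F => (a + t, a + ω ^ 2 * t, a + ω * t)) = {(a, a, a)} := by
    ext ⟨x, y, z⟩
    simp only [mem_inter, mem_image, mem_univ, true_and, mem_singleton]
    constructor
    · rintro ⟨⟨t, ht⟩, ⟨s, hs⟩⟩
      simp only [Prod.mk.injEq] at ht hs
      have hts : t = s := by linear_combination ht.1 - hs.1
      subst hts
      have h0 : (ω - ω ^ 2) * t = 0 := by linear_combination ht.2.1 - hs.2.1
      have ht0 : t = 0 := (mul_eq_zero.1 h0).resolve_left (cube_root_sub_sq_ne_zero h3 hω)
      subst ht0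
      simp only [mul_zero, add_zero] at ht
      simp [← ht.1, ← ht.2.1, ← ht.2.2]
    · intro h
      simp only [Prod.mk.injEq] at h
      obtain ⟨rfl, rfl, rfl⟩ := h
      exact ⟨⟨0, by simp⟩, ⟨0, by simp⟩⟩
  have h := sum_union_inter (f := H)
    (s₁ := univ.image (fun t : F => (a + t, a + ω * t, a + ω ^ 2 * t)))
    (s₂ := univ.image (fun t : F => (a + t, a + ω ^ 2 * t, a + ω * t)))
  rw [← hunion, hinter, sum_singleton, sum_image inj1.injOn, sum_image inj2.injOn] at h
  linarith

end Split

section Conic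

variable {F : Type*} [Field F]

theorem one_add_three_mul_sq_ne_zero (h2 : (2 : F) ≠ 0)
    (hω : ∀ ω : F, ω ^ 2 + ω + 1 ≠ 0) (t : F) : 1 + 3 * t ^ 2 ≠ 0 := by
  intro h
  have ht : t ≠ 0 := by
    rintro rfl
    simp at h
  apply hω ((-1 + 1 / t) / 2)
  field_simp
  linear_combination h

variable [Fintype F] [DecidableEq F]

/-- An anisotropic conic `b ^ 2 + 3 a ^ 2 = c` has at most `q + 1` affine points. -/
theorem card_conic_le (hani : ∀ t : F, 1 + 3 * t ^ 2 ≠ 0) {c : F} (hc : c ≠ 0)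
    (h3 : (3 : F) ≠ 0) :
    (univ.filter fun w : F × F => w.1 ^ 2 + 3 * w.2 ^ 2 = c).card ≤ Fintype.card F + 1 := by
  rcases (univ.filter fun w : F × F => w.1 ^ 2 + 3 * w.2 ^ 2 = c).eq_empty_or_nonempty with
    h | ⟨⟨b₀, a₀⟩, h₀⟩
  · simp [h]
  simp only [mem_filter, mem_univ, true_and] at h₀
  rw [← Fintype.card_option, ← card_univ]
  refine card_le_card_of_injOn (fun w => if w.1 * b₀ + 3 * w.2 * a₀ + c = 0 then none
    else some ((w.2 * b₀ - w.1 * a₀) / (w.1 * b₀ + 3 * w.2 * a₀ + c))) (by simp) ?_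
  rintro ⟨b, a⟩ h ⟨b', a'⟩ h' e
  simp only [coe_filter, mem_univ, true_and, Set.mem_ofPred_eq] at h h'
  dsimp only at e
  -- the quotient of two points of the conic has norm one
  have norm_eq : ∀ {b a : F}, b ^ 2 + 3 * a ^ 2 = c →
      (b * b₀ + 3 * a * a₀) ^ 2 + 3 * (a * b₀ - b * a₀) ^ 2 = c ^ 2 := by
    intro b a h
    linear_combination (b₀ ^ 2 + 3 * a₀ ^ 2) * h + c * h₀
  have ext_of : b * b₀ + 3 * a * a₀ = b' * b₀ + 3 * a' * a₀ →
      a * b₀ - b * a₀ = a' * b₀ - b' * a₀ → (b, a) = (b', a') := by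
    intro hR hN
    ext
    · refine mul_left_cancel₀ hc ?_
      linear_combination b₀ * hR - 3 * a₀ * hN - (b - b') * h₀
    · refine mul_left_cancel₀ hc ?_
      linear_combination a₀ * hR + b₀ * hN - (a - a') * h₀
  have n1 := norm_eq h
  have n2 := norm_eq h'
  generalize b * b₀ + 3 * a * a₀ = R at *
  generalize a * b₀ - b * a₀ = N at *
  generalize b' * b₀ + 3 * a' * a₀ = R' at *
  generalize a' * b₀ - b' * a₀ = N' at *
  have zero_of : ∀ {R N : F}, R ^ 2 + 3 * N ^ 2 = c ^ 2 → R + c = 0 → N = 0 := by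
    intro R N n hR
    have : 3 * N ^ 2 = 0 := by linear_combination n - (R - c) * hR
    simpa [h3] using this
  have param : ∀ {R N t : F}, R ^ 2 + 3 * N ^ 2 = c ^ 2 → R + c ≠ 0 → N = t * (R + c) →
      R * (1 + 3 * t ^ 2) = c * (1 - 3 * t ^ 2) := by
    intro R N t n hR hN
    refine mul_left_cancel₀ hR ?_
    rw [hN] at n
    linear_combination n
  split_ifs at e with hR hR' hR'
  · exact ext_of (by linear_combination hR - hR') ((zero_of n1 hR).trans (zero_of n2 hR').symm)
  · have e' := Option.some.inj e
    set t := N / (R + c) with ht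
    have hN : N = t * (R + c) := by rw [ht, div_mul_cancel₀ _ hR]
    have hN' : N' = t * (R' + c) := by rw [e', div_mul_cancel₀ _ hR']
    have hRR : R = R' := mul_right_cancel₀ (hani t)
      ((param n1 hR hN).trans (param n2 hR' hN').symm)
    exact ext_of hRR (by rw [hN, hN', hRR])

theorem card_parabolaTriples_le_of_no_cube_root (h2 : (2 : F) ≠ 0) (h3 : (3 : F) ≠ 0)
    (hω : ∀ ω : F, ω ^ 2 + ω + 1 ≠ 0) {ξτ : F × F} (h : 3 * ξτ.2 ≠ ξτ.1 ^ 2) :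
    ((parabolaTriples ξτ).card : ℝ) ≤ (Fintype.card F : ℝ) + 1 := by
  have hc : 2 * (3 * ξτ.2 - ξτ.1 ^ 2) ≠ 0 := mul_ne_zero h2 (sub_ne_zero.2 h)
  have hle := card_conic_le (one_add_three_mul_sq_ne_zero h2 hω) hc h3
  have hle' : (parabolaTriples ξτ).card ≤
      (univ.filter fun w : F × F => w.1 ^ 2 + 3 * w.2 ^ 2 = 2 * (3 * ξτ.2 - ξτ.1 ^ 2)).card := by
    refine card_le_card_of_injOn (fun y => (3 * y.1 - ξτ.1, y.2.1 - y.2.2)) ?_ ?_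
    · intro y hy
      obtain ⟨hs, hq⟩ := mem_parabolaTriples.1 hy
      simp only [coe_filter, mem_univ, true_and, Set.mem_ofPred_eq]
      rw [← hs, ← hq]
      ring
    · rintro ⟨x, y, z⟩ hy ⟨x', y', z'⟩ hy' e
      have hs := ((mem_parabolaTriples.1 hy).1).trans ((mem_parabolaTriples.1 hy').1).symm
      simp only [Prod.mk.injEq] at e hs
      have hx : x = x' := mul_left_cancel₀ h3 (by linear_combination e.1)
      have hyy : y = y' := mul_left_cancel₀ h2 (by linear_combination hs - hx + e.2)
      have hzz : z = z' := by linear_combination hyy - e.2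
      rw [hx, hyy, hzz]
  exact_mod_cast hle'.trans hle

theorem parabolaTriples_eq_singleton (h2 : (2 : F) ≠ 0) (h3 : (3 : F) ≠ 0)
    (hω : ∀ ω : F, ω ^ 2 + ω + 1 ≠ 0) (a : F) :
    parabolaTriples (3 * a, 3 * a ^ 2) = {(a, a, a)} := by
  ext ⟨x, y, z⟩
  simp only [mem_parabolaTriples, mem_singleton]
  constructor
  · rintro ⟨hs, hq⟩
    have e : (3 * x - 3 * a) ^ 2 + 3 * (y - z) ^ 2 = 0 := by
      linear_combination 6 * hq + (3 * x - 9 * a - 3 * y - 3 * z) * hs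
    have hx0 : 3 * x - 3 * a = 0 := by
      by_contra hne
      apply one_add_three_mul_sq_ne_zero h2 hω ((y - z) / (3 * x - 3 * a))
      generalize 3 * x - 3 * a = d at *
      field_simp
      linear_combination e
    have hyz : y - z = 0 := by
      rw [hx0] at e
      simpa [h3] using e
    have hx : x = a := mul_left_cancel₀ h3 (by linear_combination hx0)
    have hy : y = a := mul_left_cancel₀ h2 (by linear_combination hs - hx + hyz)
    have hz : z = a := by linear_combination hy - hyz
    rw [hx, hy, hz]
  · intro h
    simp only [Prod.mk.injEq] at h
    obtain ⟨rfl, rfl, rfl⟩ := h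
    constructor <;> ring

end Conic

section Extension

theorem sum_sq_triple_prod {ι : Type*} [Fintype ι] (g : ι → ℝ) :
    ∑ y : ι × ι × ι, (g y.1 * g y.2.1 * g y.2.2) ^ 2 = (∑ x, g x ^ 2) ^ 3 := by
  rw [pow_three, sum_mul_sum, Fintype.sum_mul_sum]
  simp only [Fintype.sum_prod_type, mul_sum, mul_pow, mul_assoc]

variable {F : Type*} [Field F] [Fintype F]

theorem sum_sq_pow_three_le (g : F → ℝ) :
    (∑ x, g x ^ 2) ^ 3 ≤ (Fintype.card F : ℝ) ^ 2 * ∑ x, (g x ^ 3) ^ 2 := by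
  have h := pow_sum_div_card_le_sum_pow (s := univ) (f := fun x => g x ^ 2)
    (fun x _ => sq_nonneg (g x)) 2
  rw [card_univ, div_le_iff₀ (by have : 0 < Fintype.card F := Fintype.card_pos; positivity)] at h
  norm_num [← pow_mul] at h ⊢
  linarith

variable {ω : F}

/-- The trilinear Cauchy-Schwarz (Loomis-Whitney type) bound along the lines through the diagonal
in the direction of a cube root of unity. -/
theorem sum_sq_line_le (h3 : (3 : F) ≠ 0) (hω : ω ^ 2 + ω + 1 = 0) (g : F → ℝ) :
    ∑ a, (∑ t, g (a + t) * g (a + ω * t) * g (a + ω ^ 2 * t)) ^ 2 ≤ (∑ x, g x ^ 2) ^ 3 := by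
  have hbij : Function.Bijective fun w : F × F => (w.1 + ω * w.2, w.1 + ω ^ 2 * w.2) := by
    rw [← Finite.injective_iff_bijective]
    rintro ⟨a, t⟩ ⟨b, s⟩ h
    simp only [Prod.mk.injEq] at h
    have ht : t = s := mul_left_cancel₀ (cube_root_sub_sq_ne_zero h3 hω)
      (by linear_combination h.1 - h.2)
    have ha : a = b := by linear_combination h.1 - ω * ht
    rw [ha, ht]
  have hsum : ∑ a, ∑ t, (g (a + ω * t) * g (a + ω ^ 2 * t)) ^ 2 = (∑ x, g x ^ 2) ^ 2 := by
    rw [← Fintype.sum_prod_type' (f := fun a t => (g (a + ω * t) * g (a + ω ^ 2 * t)) ^ 2),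
      hbij.sum_comp (fun w : F × F => (g w.1 * g w.2) ^ 2), sq (∑ x, g x ^ 2),
      Fintype.sum_mul_sum, Fintype.sum_prod_type]
    simp only [mul_pow]
  rw [pow_succ' _ 2, ← hsum, mul_sum]
  refine sum_le_sum fun a _ => ?_
  have h := sum_mul_sq_le_sq_mul_sq univ (fun t => g (a + t))
    (fun t => g (a + ω * t) * g (a + ω ^ 2 * t))
  rw [Fintype.sum_equiv (Equiv.addLeft a) (fun t => g (a + t) ^ 2) (fun x => g x ^ 2)
    (fun _ => rfl)] at h
  simpa only [mul_assoc] using h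

/-- Cauchy-Schwarz away from one distinguished term. -/
theorem sq_two_mul_sum_sub_le {ι : Type*} [Fintype ι] [DecidableEq ι] (P : ι → ℝ) (i : ι) :
    (2 * ∑ t, P t - P i) ^ 2 - ((Fintype.card ι : ℝ) - 1) * (2 * ∑ t, P t ^ 2 - P i ^ 2) ≤
      2 * (∑ t, P t) ^ 2 - Fintype.card ι * P i ^ 2 := by
  have h := sq_sum_le_card_mul_sum_sq (s := univ.erase i) (f := P)
  have h1 : 1 ≤ Fintype.card ι := Fintype.card_pos_iff.2 ⟨i⟩
  rw [card_erase_of_mem (mem_univ _), card_univ, Nat.cast_sub h1, Nat.cast_one,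
    sum_erase_eq_sub (mem_univ i), sum_erase_eq_sub (mem_univ i)] at h
  nlinarith

variable [DecidableEq F]

theorem sum_sq_sum_parabolaTriples_le (h2 : (2 : F) ≠ 0) (h3 : (3 : F) ≠ 0) (g : F → ℝ) :
    ∑ ξτ : F × F, (∑ y ∈ parabolaTriples ξτ, g y.1 * g y.2.1 * g y.2.2) ^ 2 ≤
      ((Fintype.card F : ℝ) + 1 - 1 / Fintype.card F) * (∑ x, g x ^ 2) ^ 3 := by
  have hq : (0 : ℝ) < Fintype.card F := by exact_mod_cast Fintype.card_pos
  have hpow : 1 / (Fintype.card F : ℝ) * (∑ x, g x ^ 2) ^ 3 ≤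
      Fintype.card F * ∑ x, (g x ^ 3) ^ 2 := by
    rw [one_div, inv_mul_le_iff₀ hq]
    linarith [sum_sq_pow_three_le g]
  by_cases hω : ∃ ω : F, ω ^ 2 + ω + 1 = 0
  · obtain ⟨ω, hω⟩ := hω
    refine (sum_sq_parabolaTriples_le h3 _
      (fun ξτ h => card_parabolaTriples_le_of_cube_root h2 h3 hω h) _).trans ?_
    rw [sum_sq_triple_prod]
    have hbr : ∀ a : F, (∑ y ∈ parabolaTriples (3 * a, 3 * a ^ 2),
          g y.1 * g y.2.1 * g y.2.2) ^ 2 - ((Fintype.card F : ℝ) - 1) *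
          ∑ y ∈ parabolaTriples (3 * a, 3 * a ^ 2), (g y.1 * g y.2.1 * g y.2.2) ^ 2 ≤
        2 * (∑ t, g (a + t) * g (a + ω * t) * g (a + ω ^ 2 * t)) ^ 2 -
          Fintype.card F * (g a ^ 3) ^ 2 := by
      intro a
      have h := sq_two_mul_sum_sub_le
        (fun t => g (a + t) * g (a + ω * t) * g (a + ω ^ 2 * t)) 0
      rw [sum_parabolaTriples_of_cube_root h2 h3 hω, sum_parabolaTriples_of_cube_root h2 h3 hω]
      simp only [mul_right_comm (g (a + _)) (g (a + ω ^ 2 * _)) (g (a + ω * _)), ← two_mul]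
      simp only [mul_zero, add_zero, ← pow_three'] at h ⊢
      exact h
    have hs := sum_le_sum fun a (_ : a ∈ (univ : Finset F)) => hbr a
    rw [sum_sub_distrib (f := fun a => 2 * _), ← mul_sum, ← mul_sum] at hs
    linarith [sum_sq_line_le h3 hω g]
  · push Not at hω
    refine (sum_sq_parabolaTriples_le h3 _
      (fun ξτ h => card_parabolaTriples_le_of_no_cube_root h2 h3 hω h) _).trans ?_
    rw [sum_sq_triple_prod]
    simp only [parabolaTriples_eq_singleton h2 h3 hω, sum_singleton, ← pow_three']
    rw [sum_sub_distrib, ← mul_sum]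
    linarith

theorem le_sum_card_sq (h2 : (2 : F) ≠ 0) (h3 : (3 : F) ≠ 0) :
    ((Fintype.card F : ℝ) + 1 - 1 / Fintype.card F) * (Fintype.card F : ℝ) ^ 3 ≤
      ∑ ξτ : F × F, ((parabolaTriples ξτ).card : ℝ) ^ 2 := by
  have hq : (Fintype.card F : ℝ) ≠ 0 := by exact_mod_cast Fintype.card_ne_zero
  by_cases hω : ∃ ω : F, ω ^ 2 + ω + 1 = 0
  · obtain ⟨ω, hω⟩ := hω
    refine le_trans (le_of_eq ?_) (le_sum_card_sq_parabolaTriples h3 ((Fintype.card F : ℝ) - 1))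
    have hc : ∀ a : F, ((parabolaTriples (3 * a, 3 * a ^ 2)).card : ℝ) =
        2 * Fintype.card F - 1 := by
      intro a
      have h := sum_parabolaTriples_of_cube_root h2 h3 hω a (fun _ => 1)
      simp only [sum_const, nsmul_eq_mul, mul_one, card_univ] at h
      linarith
    simp only [hc, sum_const, nsmul_eq_mul, card_univ]
    field_simp
    ring
  · push Not at hω
    refine le_trans (le_of_eq ?_) (le_sum_card_sq_parabolaTriples h3 ((Fintype.card F : ℝ) + 1))
    simp only [parabolaTriples_eq_singleton h2 h3 hω, card_singleton, sum_const, nsmul_eq_mul,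
      card_univ]
    field_simp
    push_cast
    ring

end Extension

/-- Sharp L²→L⁶ extension inequality from the parabola P¹ ⊂ F² in combinatorial form,
with equality for constant functions. -/
theorem parabola_P1_sharp_L2_L6_extension
    (p n q : ℕ) (hp : p.Prime) (hp3 : 3 < p) (hn : 0 < n) (hq : q = p ^ n)
    (F : Type) [Field F] [Fintype F] [DecidableEq F] (hF : Fintype.card F = q)
    (f : F → ℂ) :
    (∑ ξτ : F × F,
        ‖∑ y ∈ univ.filter (fun y : F × F × F =>
            y.1 + y.2.1 + y.2.2 = ξτ.1 ∧
            y.1 ^ 2 + y.2.1 ^ 2 + y.2.2 ^ 2 = ξτ.2),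
          f y.1 * f y.2.1 * f y.2.2‖ ^ 2)
      ≤ ((q : ℝ) + 1 - 1 / q) * (∑ ξ : F, ‖f ξ‖ ^ 2) ^ 3
    ∧ (∀ c : ℂ, (∀ ξ, f ξ = c) →
      (∑ ξτ : F × F,
        ‖∑ y ∈ univ.filter (fun y : F × F × F =>
            y.1 + y.2.1 + y.2.2 = ξτ.1 ∧
            y.1 ^ 2 + y.2.1 ^ 2 + y.2.2 ^ 2 = ξτ.2),
          f y.1 * f y.2.1 * f y.2.2‖ ^ 2)
      = ((q : ℝ) + 1 - 1 / q) * (∑ ξ : F, ‖f ξ‖ ^ 2) ^ 3) := by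
  have hchar : CharP F p := by
    have := Fact.mk hp
    exact charP_of_card_eq_prime_pow (hF.trans hq)
  have hne : ∀ k : ℕ, 0 < k → k < p → (k : F) ≠ 0 := by
    intro k hk hkp h
    exact absurd (Nat.le_of_dvd hk ((CharP.cast_eq_zero_iff F p k).1 h)) (not_le.2 hkp)
  have h2 : (2 : F) ≠ 0 := by exact_mod_cast hne 2 two_pos (by omega)
  have h3 : (3 : F) ≠ 0 := by exact_mod_cast hne 3 three_pos hp3
  change ∑ ξτ : F × F, ‖∑ y ∈ parabolaTriples ξτ, f y.1 * f y.2.1 * f y.2.2‖ ^ 2 ≤ _ ∧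
    ∀ c : ℂ, (∀ ξ, f ξ = c) →
      ∑ ξτ : F × F, ‖∑ y ∈ parabolaTriples ξτ, f y.1 * f y.2.1 * f y.2.2‖ ^ 2 = _
  rw [← hF]
  have hle : ∑ ξτ : F × F, ‖∑ y ∈ parabolaTriples ξτ, f y.1 * f y.2.1 * f y.2.2‖ ^ 2 ≤
      ((Fintype.card F : ℝ) + 1 - 1 / Fintype.card F) * (∑ ξ : F, ‖f ξ‖ ^ 2) ^ 3 := by
    refine le_trans (sum_le_sum fun ξτ _ => ?_)
      (sum_sq_sum_parabolaTriples_le h2 h3 fun x => ‖f x‖)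
    refine pow_le_pow_left₀ (norm_nonneg _) ((norm_sum_le _ _).trans_eq ?_) 2
    simp only [norm_mul]
  refine ⟨hle, fun c hc => le_antisymm hle ?_⟩
  have h := mul_le_mul_of_nonneg_right (le_sum_card_sq h2 h3) (pow_nonneg (norm_nonneg c) 6)
  simp only [hc, sum_const, nsmul_eq_mul, card_univ, norm_mul, Complex.norm_natCast]
  refine (Eq.trans_le ?_ h).trans_eq ?_
  · ring
  · rw [sum_mul]
    exact sum_congr rfl fun _ _ => by ring
end

section
/- Let p be a prime with p > 3, n a positive integer, q = p^n, and let F be a finite field with exactly q elements. If a function f : F → ℂ attains equality in ∑_{(ξ,τ) ∈ F×F} | ∑_{ξ₁+ξ₂+ξ₃=ξ, ξ₁²+ξ₂²+ξ₃²=τ} f(ξ₁)f(ξ₂)f(ξ₃) |² ≤ (q + 1 − 1/q)·(∑_{ξ∈F}|f(ξ)|²)³, then |f| is constant on F. -/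
open Finset

section ConicFibers

variable {F : Type*} [Field F] [Fintype F] [DecidableEq F]

/-- The triples of points of the parabola with sum `v`. -/
def parabolaFiber (v : F × F) : Finset (F × F × F) :=
  univ.filter fun y => y.1 + y.2.1 + y.2.2 = v.1 ∧ y.1 ^ 2 + y.2.1 ^ 2 + y.2.2 ^ 2 = v.2

lemma mem_parabolaFiber {v : F × F} {x y z : F} :
    (x, y, z) ∈ parabolaFiber v ↔ x + y + z = v.1 ∧ x ^ 2 + y ^ 2 + z ^ 2 = v.2 := by
  simp [parabolaFiber]

omit [Fintype F] [DecidableEq F] in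
lemma sq_add_mul_add_sq_eq_zero (hω : ∀ w : F, w ^ 2 + w + 1 ≠ 0) {a b : F}
    (h : a ^ 2 + a * b + b ^ 2 = 0) : a = 0 ∧ b = 0 := by
  have hb : b = 0 := by
    by_contra hb
    apply hω (a / b)
    field_simp
    linear_combination h
  subst hb
  simpa using h

/-- The second intersection point of the line through `P` in direction `(a, b, -a - b)` with the
conic `parabolaFiber` through `P`. -/
def secantPoint (P : F × F × F) (a b : F) : F × F × F :=
  let t := -(P.1 * a + P.2.1 * b - P.2.2 * (a + b)) / (a ^ 2 + a * b + b ^ 2)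
  (P.1 + t * a, P.2.1 + t * b, P.2.2 - t * (a + b))

omit [Fintype F] [DecidableEq F] in
lemma secantPoint_smul (P : F × F × F) {c : F} (hc : c ≠ 0) (a b : F) :
    secantPoint P (c * a) (c * b) = secantPoint P a b := by
  have h : -(P.1 * (c * a) + P.2.1 * (c * b) - P.2.2 * (c * a + c * b)) /
        ((c * a) ^ 2 + c * a * (c * b) + (c * b) ^ 2) * c =
      -(P.1 * a + P.2.1 * b - P.2.2 * (a + b)) / (a ^ 2 + a * b + b ^ 2) := by
    rw [show (c * a) ^ 2 + c * a * (c * b) + (c * b) ^ 2 = c ^ 2 * (a ^ 2 + a * b + b ^ 2) by ring]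
    by_cases hQ : a ^ 2 + a * b + b ^ 2 = 0
    · simp [hQ]
    · field_simp
  simp only [secantPoint, ← h, Prod.mk.injEq]
  refine ⟨by ring, by ring, by ring⟩

lemma card_parabolaFiber_le_of_anisotropic (h2 : (2 : F) ≠ 0)
    (hω : ∀ w : F, w ^ 2 + w + 1 ≠ 0) {v : F × F} (hv : 3 * v.2 ≠ v.1 ^ 2) :
    #(parabolaFiber v) ≤ Fintype.card F + 1 := by
  obtain h | ⟨⟨x₀, y₀, z₀⟩, hP⟩ := (parabolaFiber v).eq_empty_or_nonempty
  · simp [h]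
  rw [← Fintype.card_option, ← card_univ]
  refine (card_le_card ?_).trans (card_image_le (s := univ)
    (f := fun o : Option F => o.elim (secantPoint (x₀, y₀, z₀) 0 1)
      fun m => secantPoint (x₀, y₀, z₀) 1 m))
  rintro ⟨x, y, z⟩ h
  rw [mem_parabolaFiber] at hP h
  suffices ∃ a b : F, (a ≠ 0 ∨ b ≠ 0) ∧ secantPoint (x₀, y₀, z₀) a b = (x, y, z) by
    obtain ⟨a, b, hab, h⟩ := this
    rw [mem_image]
    by_cases ha : a = 0
    · subst ha
      refine ⟨none, mem_univ _, ?_⟩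
      rw [← h]
      simpa using (secantPoint_smul (x₀, y₀, z₀) (hab.resolve_left (by simp)) 0 1).symm
    · refine ⟨some (b / a), mem_univ _, ?_⟩
      rw [← h]
      simpa [mul_div_cancel₀ _ ha] using (secantPoint_smul (x₀, y₀, z₀) ha 1 (b / a)).symm
  by_cases hx : x = x₀ ∧ y = y₀
  · obtain ⟨rfl, rfl⟩ := hx
    have hz : z = z₀ := by linear_combination h.1 - hP.1
    subst hz
    refine ⟨y - z, z - x, ?_, ?_⟩
    · by_contra! h0
      apply hv
      rw [← h.1, ← h.2]
      have e1 : y = z := by linear_combination h0.1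
      have e2 : z = x := by linear_combination h0.2
      subst e1 e2
      ring
    · have : x * (y - z) + y * (z - x) - z * (y - z + (z - x)) = 0 := by ring
      simp only [secantPoint, this, neg_zero, zero_div, zero_mul, add_zero, sub_zero]
  · refine ⟨x - x₀, y - y₀, ?_, ?_⟩
    · rw [← not_and_or, sub_eq_zero, sub_eq_zero]
      exact hx
    · have hQ : (x - x₀) ^ 2 + (x - x₀) * (y - y₀) + (y - y₀) ^ 2 ≠ 0 := fun h0 => by
        have := sq_add_mul_add_sq_eq_zero hω h0
        exact hx ⟨sub_eq_zero.1 this.1, sub_eq_zero.1 this.2⟩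
      have ez : z = v.1 - x - y := by linear_combination h.1
      have ez₀ : z₀ = v.1 - x₀ - y₀ := by linear_combination hP.1
      have ht : -(x₀ * (x - x₀) + y₀ * (y - y₀) - z₀ * (x - x₀ + (y - y₀))) /
          ((x - x₀) ^ 2 + (x - x₀) * (y - y₀) + (y - y₀) ^ 2) = 1 := by
        rw [div_eq_one_iff_eq hQ]
        apply mul_left_cancel₀ h2
        have := h.2.trans hP.2.symm
        subst ez ez₀
        linear_combination -this
      simp only [secantPoint, ht, Prod.mk.injEq]
      refine ⟨by ring, by ring, ?_⟩
      rw [ez, ez₀]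
      ring

lemma card_parabolaFiber_le_of_root (h3 : (3 : F) ≠ 0) {w : F} (hw : w ^ 2 + w + 1 = 0)
    {v : F × F} (h2 : (2 : F) ≠ 0) (hv : 3 * v.2 ≠ v.1 ^ 2) :
    #(parabolaFiber v) ≤ Fintype.card F - 1 := by
  have key : ∀ x y z : F, (x, y, z) ∈ parabolaFiber v →
      2 * ((x + w * y + w ^ 2 * z) * (x + w ^ 2 * y + w * z)) = 3 * v.2 - v.1 ^ 2 := by
    intro x y z h
    rw [mem_parabolaFiber] at h
    rw [← h.1, ← h.2]
    have hw3 : w ^ 3 = 1 := by linear_combination (w - 1) * hw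
    have hw4 : w ^ 4 = w := by linear_combination w * hw3
    ring_nf
    simp only [hw3, hw4]
    linear_combination 2 * (x * y + y * z + x * z) * hw
  have hne : ∀ x y z : F, (x, y, z) ∈ parabolaFiber v → x + w * y + w ^ 2 * z ≠ 0 := by
    intro x y z h h0
    have := key x y z h
    rw [h0] at this
    apply hv
    linear_combination -this
  rw [← card_univ, ← card_erase_of_mem (mem_univ (0 : F))]
  refine card_le_card_of_injOn (fun y => y.1 + w * y.2.1 + w ^ 2 * y.2.2) ?_ ?_
  · rintro ⟨x, y, z⟩ h
    simpa using hne x y z h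
  · rintro ⟨x, y, z⟩ h ⟨x', y', z'⟩ h' hX
    simp only at hX
    have hY : x + w ^ 2 * y + w * z = x' + w ^ 2 * y' + w * z' := by
      apply mul_left_cancel₀ (mul_ne_zero h2 (hne x y z h))
      have e := (key x y z h).trans (key x' y' z' h').symm
      rw [← hX] at e
      linear_combination e
    have hS := (mem_parabolaFiber.1 h).1.trans (mem_parabolaFiber.1 h').1.symm
    have hw3 : w ^ 3 = 1 := by linear_combination (w - 1) * hw
    have ex : x = x' := by
      apply mul_left_cancel₀ h3
      linear_combination hS + hX + hY - (y + z - y' - z') * hw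
    have ey : y = y' := by
      apply mul_left_cancel₀ h3
      linear_combination hS + w ^ 2 * hX + w * hY - (x - x') * hw
        - (2 * (y - y') + w * (z - z')) * hw3 - (z - z') * hw
    subst ex ey
    simpa using hS

lemma parabolaFiber_diag_of_anisotropic (h2 : (2 : F) ≠ 0)
    (hω : ∀ w : F, w ^ 2 + w + 1 ≠ 0) (t : F) :
    parabolaFiber (3 * t, 3 * t ^ 2) = {(t, t, t)} := by
  ext ⟨x, y, z⟩
  rw [mem_parabolaFiber, mem_singleton]
  constructor
  · rintro ⟨h1, h⟩
    have ez : z = 3 * t - x - y := by linear_combination h1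
    subst ez
    have := sq_add_mul_add_sq_eq_zero hω (a := x - t) (b := y - t) (by
      apply mul_left_cancel₀ h2
      linear_combination h)
    have ex := sub_eq_zero.1 this.1
    have ey := sub_eq_zero.1 this.2
    subst ex ey
    simp only [Prod.mk.injEq, true_and]
    ring
  · rintro ⟨⟩
    constructor <;> ring

omit [Fintype F] [DecidableEq F] in
lemma ne_sq_of_root (h3 : (3 : F) ≠ 0) {w : F} (hw : w ^ 2 + w + 1 = 0) : w ≠ w ^ 2 := by
  intro h
  have hw0 : w * (w - 1) = 0 := by linear_combination -h
  rcases mul_eq_zero.1 hw0 with h | h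
  · simp [h] at hw
  · rw [sub_eq_zero.1 h] at hw
    apply h3
    linear_combination hw

lemma sum_parabolaFiber_diag_of_root (h2 : (2 : F) ≠ 0) (h3 : (3 : F) ≠ 0)
    {w : F} (hw : w ^ 2 + w + 1 = 0) (t : F) (h : F × F × F → ℝ) :
    ∑ y ∈ parabolaFiber (3 * t, 3 * t ^ 2), h y =
      (∑ a ∈ univ.erase 0, h (t + a, t + w * a, t + w ^ 2 * a)) +
      (∑ a ∈ univ.erase 0, h (t + a, t + w ^ 2 * a, t + w * a)) + h (t, t, t) := by
  have hne := ne_sq_of_root h3 hw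
  have hdecomp : parabolaFiber (3 * t, 3 * t ^ 2) =
      ((univ.erase 0).image fun a : F => (t + a, t + w * a, t + w ^ 2 * a)) ∪
      (univ.image fun a : F => (t + a, t + w ^ 2 * a, t + w * a)) := by
    ext ⟨x, y, z⟩
    simp only [mem_parabolaFiber, mem_union, mem_image, mem_erase, mem_univ, Prod.mk.injEq,
      true_and, and_true]
    constructor
    · rintro ⟨h1, hq⟩
      have ez : z = 3 * t - x - y := by linear_combination h1
      subst ez
      have hprod : ((y - t) - w * (x - t)) * ((y - t) - w ^ 2 * (x - t)) = 0 := by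
        apply mul_left_cancel₀ h2
        have hw3 : w ^ 3 = 1 := by linear_combination (w - 1) * hw
        linear_combination hq + 2 * (x - t) ^ 2 * hw3 - 2 * (x - t) * (y - t) * hw
      rcases mul_eq_zero.1 hprod with e | e
      · by_cases hx : x - t = 0
        · right
          refine ⟨0, ?_, ?_, ?_⟩
          · linear_combination -hx
          · linear_combination -e - w * hx
          · linear_combination e + (1 + w) * hx
        · left
          refine ⟨x - t, hx, by ring, ?_, ?_⟩
          · linear_combination -e
          · linear_combination e + (x - t) * hw
      · right
        refine ⟨x - t, by ring, ?_, ?_⟩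
        · linear_combination -e
        · linear_combination e + (x - t) * hw
    · have hw3 : w ^ 3 = 1 := by linear_combination (w - 1) * hw
      have hw4 : w ^ 4 = w := by linear_combination w * hw3
      rintro (⟨a, -, rfl, rfl, rfl⟩ | ⟨a, rfl, rfl, rfl⟩) <;> constructor
      · linear_combination a * hw
      · linear_combination (2 * t * a + a ^ 2) * hw + a ^ 2 * hw4
      · linear_combination a * hw
      · linear_combination (2 * t * a + a ^ 2) * hw + a ^ 2 * hw4
  rw [hdecomp, sum_union, sum_image, sum_image, ← sum_erase_add univ _ (mem_univ (0 : F))]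
  · simp [add_assoc]
  · intro a _ b _ hab
    simpa using congrArg Prod.fst hab
  · intro a _ b _ hab
    simpa using congrArg Prod.fst hab
  · rw [disjoint_left]
    simp only [mem_image, mem_erase, mem_univ, and_true, true_and, not_exists]
    rintro _ ⟨a, ha, rfl⟩ b hab
    simp only [Prod.mk.injEq, add_right_inj] at hab
    obtain ⟨rfl, h', -⟩ := hab
    exact hne (mul_right_cancel₀ ha h').symm

end ConicFibers

section Inequality

variable {F : Type*} [Field F] [Fintype F] [DecidableEq F]

/-- The tensor cube of `u`. -/
def tensorCube (u : F → ℝ) (y : F × F × F) : ℝ := u y.1 * u y.2.1 * u y.2.2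

omit [Field F] [DecidableEq F] in
lemma sum_tensorCube_sq (u : F → ℝ) : ∑ y, tensorCube u y ^ 2 = (∑ x, u x ^ 2) ^ 3 := by
  simp only [tensorCube, Fintype.sum_prod_type, mul_pow, ← mul_sum, ← sum_mul]
  ring

lemma sum_sum_parabolaFiber (h : F × F × F → ℝ) :
    ∑ v : F × F, ∑ y ∈ parabolaFiber v, h y = ∑ y, h y := by
  rw [← sum_fiberwise univ
    (fun y : F × F × F => (y.1 + y.2.1 + y.2.2, y.1 ^ 2 + y.2.1 ^ 2 + y.2.2 ^ 2)) h]
  refine sum_congr rfl fun v _ => sum_congr ?_ fun _ _ => rfl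
  ext y
  simp [parabolaFiber, Prod.ext_iff]

lemma sum_filter_diag (h3 : (3 : F) ≠ 0) (g : F × F → ℝ) :
    ∑ v ∈ univ.filter (fun v : F × F => 3 * v.2 = v.1 ^ 2), g v =
      ∑ t, g (3 * t, 3 * t ^ 2) := by
  symm
  refine sum_bij (fun t _ => (3 * t, 3 * t ^ 2)) ?_ ?_ ?_ fun _ _ => rfl
  · intro t _
    simp only [mem_filter, mem_univ, true_and]
    ring
  · intro a _ b _ hab
    exact mul_left_cancel₀ h3 (congrArg Prod.fst hab)
  · rintro ⟨ξ, τ⟩ h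
    simp only [mem_filter, mem_univ, true_and] at h
    refine ⟨ξ / 3, mem_univ _, ?_⟩
    simp only [Prod.mk.injEq]
    constructor
    · field_simp
    · field_simp
      exact h.symm

lemma sum_sq_parabolaFiber_le (h3 : (3 : F) ≠ 0) {k : ℝ}
    (hk : ∀ v : F × F, 3 * v.2 ≠ v.1 ^ 2 → (#(parabolaFiber v) : ℝ) ≤ k)
    (h : F × F × F → ℝ) :
    ∑ v : F × F, (∑ y ∈ parabolaFiber v, h y) ^ 2 ≤
      k * ∑ y, h y ^ 2 + ∑ t : F, ((∑ y ∈ parabolaFiber (3 * t, 3 * t ^ 2), h y) ^ 2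
        - k * ∑ y ∈ parabolaFiber (3 * t, 3 * t ^ 2), h y ^ 2) := by
  rw [← sum_sum_parabolaFiber fun y => h y ^ 2, sum_sub_distrib, ← mul_sum,
    ← sum_filter_diag h3 fun v => (∑ y ∈ parabolaFiber v, h y) ^ 2,
    ← sum_filter_diag h3 fun v => ∑ y ∈ parabolaFiber v, h y ^ 2,
    ← sum_filter_add_sum_filter_not univ (fun v : F × F => 3 * v.2 = v.1 ^ 2)
      fun v => (∑ y ∈ parabolaFiber v, h y) ^ 2,
    ← sum_filter_add_sum_filter_not univ (fun v : F × F => 3 * v.2 = v.1 ^ 2)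
      fun v => ∑ y ∈ parabolaFiber v, h y ^ 2]
  have : ∑ v ∈ univ.filter (fun v : F × F => ¬ 3 * v.2 = v.1 ^ 2),
        (∑ y ∈ parabolaFiber v, h y) ^ 2 ≤
      k * ∑ v ∈ univ.filter (fun v : F × F => ¬ 3 * v.2 = v.1 ^ 2),
        ∑ y ∈ parabolaFiber v, h y ^ 2 := by
    rw [mul_sum]
    refine sum_le_sum fun v hv => sq_sum_le_card_mul_sum_sq.trans ?_
    exact mul_le_mul_of_nonneg_right (hk v (by simpa using hv))
      (sum_nonneg fun _ _ => sq_nonneg _)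
  linarith

omit [DecidableEq F] in
/-- A Brascamp–Lieb inequality for the lines in direction `(1, w, w ^ 2)`. -/
lemma sum_sq_sum_line_le {w : F} (h1 : w ≠ 1) (h0 : w ≠ 0) (u : F → ℝ) :
    ∑ t, (∑ a, tensorCube u (t + a, t + w * a, t + w ^ 2 * a)) ^ 2 ≤
      (∑ x, u x ^ 2) ^ 3 := by
  set S : F → ℝ := fun t => ∑ a, tensorCube u (t + a, t + w * a, t + w ^ 2 * a) with hS
  set W := ∑ t, S t ^ 2 with hW
  set U := ∑ x, u x ^ 2 with hU
  have hU0 : 0 ≤ U := sum_nonneg fun _ _ => sq_nonneg _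
  have hW0 : 0 ≤ W := sum_nonneg fun _ _ => sq_nonneg _
  have e : W = ∑ y : F × F, (u (y.1 + y.2) * u (y.1 + w * y.2)) *
      (u (y.1 + w ^ 2 * y.2) * S y.1) := by
    rw [Fintype.sum_prod_type]
    refine sum_congr rfl fun t _ => ?_
    simp only
    rw [sq]
    nth_rewrite 1 [hS]
    simp only [tensorCube]
    rw [sum_mul]
    exact sum_congr rfl fun a _ => by ring
  have e1 : ∑ y : F × F, (u (y.1 + y.2) * u (y.1 + w * y.2)) ^ 2 = U ^ 2 := by
    have hinj : Function.Injective fun y : F × F => (y.1 + y.2, y.1 + w * y.2) := by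
      rintro ⟨t, a⟩ ⟨t', a'⟩ h
      simp only [Prod.mk.injEq] at h
      have ha : a = a' := by
        apply mul_left_cancel₀ (sub_ne_zero.2 h1)
        linear_combination h.2 - h.1
      subst ha
      simpa using h.1
    rw [hU, sq, Fintype.sum_mul_sum, ← Fintype.sum_prod_type'
      (f := fun x y => u x ^ 2 * u y ^ 2)]
    exact Fintype.sum_bijective _ (Finite.injective_iff_bijective.1 hinj) _ _
      fun y => mul_pow _ _ _
  have e2 : ∑ y : F × F, (u (y.1 + w ^ 2 * y.2) * S y.1) ^ 2 = U * W := by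
    rw [Fintype.sum_prod_type, hW, mul_sum]
    refine sum_congr rfl fun t _ => ?_
    simp only [mul_pow]
    rw [← sum_mul]
    congr 1
    have hinj : Function.Injective fun a : F => t + w ^ 2 * a := fun a b h =>
      mul_left_cancel₀ (pow_ne_zero 2 h0) (add_left_cancel h)
    exact Fintype.sum_bijective _ (Finite.injective_iff_bijective.1 hinj) _ _ fun _ => rfl
  have hCS := sum_mul_sq_le_sq_mul_sq univ
    (fun y : F × F => u (y.1 + y.2) * u (y.1 + w * y.2))
    (fun y : F × F => u (y.1 + w ^ 2 * y.2) * S y.1)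
  rw [← e, e1, e2] at hCS
  rcases hW0.eq_or_lt with h | h
  · rw [← h]
    positivity
  · refine le_of_mul_le_mul_right ?_ h
    linarith

lemma sum_sq_parabolaFiber_tensorCube_le (h2 : (2 : F) ≠ 0) (h3 : (3 : F) ≠ 0) (u : F → ℝ) :
    ∑ v : F × F, (∑ y ∈ parabolaFiber v, tensorCube u y) ^ 2 ≤
      (Fintype.card F + 1) * (∑ x, u x ^ 2) ^ 3 - Fintype.card F * ∑ x, u x ^ 6 := by
  by_cases hω : ∀ w : F, w ^ 2 + w + 1 ≠ 0
  · refine (sum_sq_parabolaFiber_le h3 (k := Fintype.card F + 1) (fun v hv => ?_) _).trans ?_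
    · exact_mod_cast card_parabolaFiber_le_of_anisotropic h2 hω hv
    · rw [sum_tensorCube_sq, sub_eq_add_neg, mul_sum, ← sum_neg_distrib]
      gcongr with t
      rw [parabolaFiber_diag_of_anisotropic h2 hω, sum_singleton, sum_singleton]
      simp only [tensorCube]
      apply le_of_eq
      ring
  · push Not at hω
    obtain ⟨w, hw⟩ := hω
    have hne := ne_sq_of_root h3 hw
    have hcard : ((Fintype.card F - 1 : ℕ) : ℝ) = Fintype.card F - 1 := by
      rw [Nat.cast_sub Fintype.card_pos, Nat.cast_one]
    refine (sum_sq_parabolaFiber_le h3 (k := Fintype.card F - 1) (fun v hv => ?_) _).trans ?_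
    · rw [← hcard]
      exact_mod_cast card_parabolaFiber_le_of_root h3 hw h2 hv
    · have hBL := sum_sq_sum_line_le (w := w) (fun h => hne (by simp [h]))
        (fun h => hne (by simp [h])) u
      rw [sum_tensorCube_sq]
      have hpt : ∀ t : F, (∑ y ∈ parabolaFiber (3 * t, 3 * t ^ 2), tensorCube u y) ^ 2
          - (Fintype.card F - 1) *
            ∑ y ∈ parabolaFiber (3 * t, 3 * t ^ 2), tensorCube u y ^ 2 ≤
          2 * (∑ a, tensorCube u (t + a, t + w * a, t + w ^ 2 * a)) ^ 2
            - Fintype.card F * u t ^ 6 := by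
        intro t
        rw [sum_parabolaFiber_diag_of_root h2 h3 hw, sum_parabolaFiber_diag_of_root h2 h3 hw,
          ← sum_erase_add univ _ (mem_univ (0 : F))]
        have hsymm : ∀ a, tensorCube u (t + a, t + w ^ 2 * a, t + w * a) =
            tensorCube u (t + a, t + w * a, t + w ^ 2 * a) := fun a => by
          simp only [tensorCube]
          ring
        simp only [hsymm]
        have hCS := sq_sum_le_card_mul_sum_sq (s := univ.erase (0 : F))
          (f := fun a => tensorCube u (t + a, t + w * a, t + w ^ 2 * a))
        rw [card_erase_of_mem (mem_univ _), card_univ, hcard] at hCS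
        have hM : tensorCube u (t, t, t) = u t ^ 3 := by
          simp only [tensorCube]
          ring
        simp only [mul_zero, add_zero, hM]
        linarith
      have := sum_le_sum fun t (_ : t ∈ univ) => hpt t
      rw [sum_sub_distrib (f := fun t => 2 * _ ^ 2), ← mul_sum, ← mul_sum] at this
      linarith

end Inequality

/-- Equality case of the power mean inequality between exponents `1` and `3`. -/
lemma eq_mean_of_sum_cube_le {ι : Type*} [Fintype ι] [Nonempty ι] {a : ι → ℝ}
    (ha : ∀ i, 0 ≤ a i)
    (h : (Fintype.card ι : ℝ) ^ 2 * ∑ i, a i ^ 3 ≤ (∑ i, a i) ^ 3) (i : ι) :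
    a i = (∑ j, a j) / Fintype.card ι := by
  have hc : (0 : ℝ) < Fintype.card ι := by exact_mod_cast Fintype.card_pos
  set m := (∑ j, a j) / Fintype.card ι with hm
  have hsum : ∑ j, a j = Fintype.card ι * m := by
    rw [hm]
    field_simp
  have hm0 : 0 ≤ m := div_nonneg (sum_nonneg fun j _ => ha j) hc.le
  have hterm : ∀ j, 0 ≤ (a j - m) ^ 2 * (a j + 2 * m) := fun j =>
    mul_nonneg (sq_nonneg _) (by linarith [ha j])
  have htot : ∑ j, (a j - m) ^ 2 * (a j + 2 * m) ≤ 0 := by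
    have e : ∑ j, (a j - m) ^ 2 * (a j + 2 * m) = ∑ j, a j ^ 3 - Fintype.card ι * m ^ 3 := by
      have : ∀ j, (a j - m) ^ 2 * (a j + 2 * m) = a j ^ 3 - 3 * m ^ 2 * a j + 2 * m ^ 3 :=
        fun j => by ring
      simp only [this, sum_add_distrib, sum_sub_distrib, ← mul_sum, hsum, sum_const, card_univ,
        nsmul_eq_mul]
      ring
    rw [e]
    rw [hsum] at h
    refine le_of_mul_le_mul_left ?_ (pow_pos hc 2)
    linarith
  have hz := (sum_eq_zero_iff_of_nonneg fun j _ => hterm j).1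
    (le_antisymm htot (sum_nonneg fun j _ => hterm j)) i (mem_univ i)
  rcases mul_eq_zero.1 hz with h' | h'
  · exact sub_eq_zero.1 (pow_eq_zero_iff two_ne_zero |>.1 h')
  · linarith [ha i]

/-- Any maximizer of the sharp L²→L⁶ extension inequality from the parabola P¹ ⊂ F²
has constant modulus. -/
theorem parabola_P1_maximizers_constant_modulus
    (p n q : ℕ) (hp : p.Prime) (hp3 : 3 < p) (hn : 0 < n) (hq : q = p ^ n)
    (F : Type) [Field F] [Fintype F] [DecidableEq F] (hF : Fintype.card F = q)
    (f : F → ℂ)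
    (heq : (∑ ξτ : F × F,
        ‖∑ y ∈ univ.filter (fun y : F × F × F =>
            y.1 + y.2.1 + y.2.2 = ξτ.1 ∧
            y.1 ^ 2 + y.2.1 ^ 2 + y.2.2 ^ 2 = ξτ.2),
          f y.1 * f y.2.1 * f y.2.2‖ ^ 2)
      = ((q : ℝ) + 1 - 1 / q) * (∑ ξ : F, ‖f ξ‖ ^ 2) ^ 3) :
    ∃ c : ℝ, ∀ ξ : F, ‖f ξ‖ = c := by
  have hcard : (Fintype.card F : ℝ) = q := by exact_mod_cast hF
  have hcop : ∀ m : ℕ, 0 < m → m < p → (m : F) ≠ 0 := by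
    intro m hm hmp h
    have hp0 : (p : F) = 0 := by
      have := FiniteField.cast_card_eq_zero F
      rw [hF, hq, Nat.cast_pow] at this
      exact pow_eq_zero_iff hn.ne' |>.1 this
    have hc : Nat.Coprime m p := (Nat.coprime_of_lt_prime hm.ne' hmp hp).symm
    have := (Nat.isCoprime_iff_coprime.2 hc).map (Int.castRingHom F)
    simp [h, hp0] at this
  have h2 : (2 : F) ≠ 0 := by exact_mod_cast hcop 2 (by norm_num) (by omega)
  have h3 : (3 : F) ≠ 0 := by exact_mod_cast hcop 3 (by norm_num) hp3
  have hle := sum_sq_parabolaFiber_tensorCube_le h2 h3 fun x => ‖f x‖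
  have htri : (∑ ξτ : F × F,
        ‖∑ y ∈ univ.filter (fun y : F × F × F =>
            y.1 + y.2.1 + y.2.2 = ξτ.1 ∧
            y.1 ^ 2 + y.2.1 ^ 2 + y.2.2 ^ 2 = ξτ.2),
          f y.1 * f y.2.1 * f y.2.2‖ ^ 2) ≤
      ∑ v : F × F, (∑ y ∈ parabolaFiber v, tensorCube (fun x => ‖f x‖) y) ^ 2 := by
    refine sum_le_sum fun v _ => pow_le_pow_left₀ (norm_nonneg _) ((norm_sum_le _ _).trans ?_) 2
    simp only [norm_mul, tensorCube, parabolaFiber, le_refl]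
  rw [heq] at htri
  have h := htri.trans hle
  rw [hcard] at h
  have hq0 : (0 : ℝ) < q := by
    rw [← hcard]
    exact_mod_cast Fintype.card_pos
  have hmean := eq_mean_of_sum_cube_le (a := fun x => ‖f x‖ ^ 2) (fun x => sq_nonneg _) (by
    simp only [← pow_mul, hcard]
    norm_num
    have e : (q : ℝ) * (1 / q * (∑ x, ‖f x‖ ^ 2) ^ 3) = (∑ x, ‖f x‖ ^ 2) ^ 3 := by
      field_simp
    have h' : (q : ℝ) * ∑ x, ‖f x‖ ^ 6 ≤ 1 / q * (∑ x, ‖f x‖ ^ 2) ^ 3 := by linarith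
    have := mul_le_mul_of_nonneg_left h' hq0.le
    linarith)
  refine ⟨√((∑ x, ‖f x‖ ^ 2) / Fintype.card F), fun ξ => ?_⟩
  rw [← hmean ξ, Real.sqrt_sq (norm_nonneg _)]
end

section
/- Let p be an odd prime, n a positive integer, q = p^n, and let F be a finite field with exactly q elements. For ξ = (ξ₁,ξ₂) ∈ F², write ξ⊙ξ = ξ₁² − ξ₂². For every function f : F² → ℂ one has ∑_{(ξ,τ) ∈ F²×F} | ∑_{(ξ₁,ξ₂) ∈ F²×F² with ξ₁+ξ₂=ξ and ξ₁⊙ξ₁+ξ₂⊙ξ₂=τ} f(ξ₁)f(ξ₂) |² ≤ (q + 1 − 1/q) · ( ∑_{ξ ∈ F²} |f(ξ)|² )², and equality holds whenever f is a constant function. (This is the combinatorial form of the sharp L²→L⁴ extension inequality from the hyperbolic paraboloid H² ⊂ F³, with best constant R*_{H²}(2→4) = (1 + q⁻¹ − q⁻²)^{1/4}.) -/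
open Finset

lemma bijective_add_sub {A : Type*} [AddCommGroup A] [Finite A]
    (hA : Function.Injective fun a : A => a + a) :
    Function.Bijective (fun x : A × A => (x.1 + x.2, x.1 - x.2)) := by
  rw [← Finite.injective_iff_bijective]
  rintro ⟨a, b⟩ ⟨c, d⟩ h
  simp only [Prod.mk.injEq] at h ⊢
  have hac : a = c := hA <| by
    calc a + a = a + b + (a - b) := by abel
      _ = c + d + (c - d) := by rw [h.1, h.2]
      _ = c + c := by abel
  exact ⟨hac, by simpa [hac] using h.1⟩

lemma injective_add_self {F : Type*} [Field F] (h2 : (2 : F) ≠ 0) :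
    Function.Injective fun a : F => a + a :=
  fun a b h => mul_left_cancel₀ h2 (by simpa only [two_mul] using h)

lemma sum_sum_mul_reflection {F : Type*} [Field F] [Fintype F] (h2 : (2 : F) ≠ 0) (φ : F × F → ℝ) :
    ∑ m, ∑ η, φ (m + η) * φ (m - η) = (∑ m, φ m) ^ 2 := by
  rw [sq, sum_mul_sum, ← Fintype.sum_prod_type', ← Fintype.sum_prod_type']
  refine Fintype.sum_bijective _ (bijective_add_sub ?_) _ _ fun _ => rfl
  exact fun a b h => Prod.ext (injective_add_self h2 (congrArg Prod.fst h))
    (injective_add_self h2 (congrArg Prod.snd h))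

lemma sum_isotropic_coordinates {F : Type*} [Field F] [Fintype F] (h2 : (2 : F) ≠ 0)
    (φ : F × F → ℝ) :
    ∑ x : F × F, φ (x.1 + x.2, x.1 - x.2) = ∑ x, φ x :=
  (bijective_add_sub (injective_add_self h2)).sum_comp φ

section HyperbolicParaboloid

variable {F : Type*} [Field F] [Fintype F] [DecidableEq F]

/-- Reindexing of the energy by the centre `m` of a pair, half its difference `η`, and isotropic
coordinates, in which the quadratic form is a multiple of `η.1 * η.2`. -/
lemma sum_norm_sq_eq_sum_center (h2 : (2 : F) ≠ 0) (f : F × F → ℂ) :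
    (∑ ξτ : (F × F) × F,
        ‖∑ y ∈ univ.filter (fun y : (F × F) × (F × F) =>
            y.1 + y.2 = ξτ.1 ∧
            (y.1.1 ^ 2 - y.1.2 ^ 2) + (y.2.1 ^ 2 - y.2.2 ^ 2) = ξτ.2),
          f y.1 * f y.2‖ ^ 2) =
      ∑ m : F × F, ∑ t : F, ‖∑ η ∈ univ.filter (fun η : F × F => η.1 * η.2 = t),
        f ((m + η).1 + (m + η).2, (m + η).1 - (m + η).2) *
          f ((m - η).1 + (m - η).2, (m - η).1 - (m - η).2)‖ ^ 2 := by
  have h4 : (4 : F) ≠ 0 := by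
    rw [show (4 : F) = 2 * 2 by norm_num]
    exact mul_ne_zero h2 h2
  have h8 : (8 : F) ≠ 0 := by
    rw [show (8 : F) = 2 * 4 by norm_num]
    exact mul_ne_zero h2 h4
  rw [← Fintype.sum_prod_type']
  symm
  refine Fintype.sum_bijective (fun x : (F × F) × F =>
    (((2 * (x.1.1 + x.1.2), 2 * (x.1.1 - x.1.2)) : F × F), 8 * (x.1.1 * x.1.2 + x.2)))
    ?_ _ _ ?_
  · rw [← Finite.injective_iff_bijective]
    rintro ⟨⟨a, b⟩, t⟩ ⟨⟨c, d⟩, s⟩ h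
    simp only [Prod.mk.injEq] at h ⊢
    have hab := (bijective_add_sub (injective_add_self h2)).1 (a₁ := (a, b)) (a₂ := (c, d))
      (Prod.ext (mul_left_cancel₀ h2 h.1.1) (mul_left_cancel₀ h2 h.1.2) :
        ((a + b, a - b) : F × F) = (c + d, c - d))
    obtain ⟨rfl, rfl⟩ := Prod.mk.inj hab
    exact ⟨⟨rfl, rfl⟩, add_left_cancel (mul_left_cancel₀ h8 h.2)⟩
  · rintro ⟨⟨a, b⟩, t⟩
    congr 2
    refine sum_nbij'
      (fun η => ((a + η.1 + (b + η.2), a + η.1 - (b + η.2)),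
        (a - η.1 + (b - η.2), a - η.1 - (b - η.2))))
      (fun y => ((y.1.1 + y.1.2 - y.2.1 - y.2.2) / 4, (y.1.1 - y.1.2 - y.2.1 + y.2.2) / 4))
      ?_ ?_ ?_ ?_ ?_
    · rintro ⟨x, y⟩ h
      simp only [mem_filter, mem_univ, true_and, Prod.mk_add_mk, Prod.mk.injEq] at h ⊢
      grind
    · rintro ⟨⟨x, y⟩, ⟨z, w⟩⟩ h
      simp only [mem_filter, mem_univ, true_and, Prod.mk_add_mk, Prod.mk.injEq] at h ⊢
      obtain ⟨⟨hx, hy⟩, hτ⟩ := h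
      rw [div_mul_div_comm, div_eq_iff (mul_ne_zero h4 h4)]
      linear_combination 2 * hτ - (x + z + 2 * (a + b)) * hx + (y + w + 2 * (a - b)) * hy
    · rintro ⟨x, y⟩ h
      simp only [Prod.mk.injEq]
      constructor <;> field_simp <;> ring
    · rintro ⟨⟨x, y⟩, ⟨z, w⟩⟩ h
      simp only [mem_filter, mem_univ, true_and, Prod.mk_add_mk, Prod.mk.injEq] at h ⊢
      obtain ⟨⟨hx, hy⟩, hτ⟩ := h
      refine ⟨⟨?_, ?_⟩, ?_, ?_⟩ <;> field_simp
      · linear_combination -2 * hx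
      · linear_combination -2 * hy
      · linear_combination -2 * hx
      · linear_combination -2 * hy
    · rintro ⟨x, y⟩ h
      simp

lemma sum_mul_eq_zero (G : F × F → ℝ) :
    ∑ η ∈ univ.filter (fun η : F × F => η.1 * η.2 = 0), G η =
      ∑ a, G (a, 0) + ∑ b, G (0, b) - G (0, 0) := by
  have key : ∀ x y : F, (if x * y = 0 then G (x, y) else 0) =
      (if y = 0 then G (x, y) else 0) + (if x = 0 then G (x, y) else 0) -
        (if x = 0 then if y = 0 then G (x, y) else 0 else 0) := by
    intro x y
    by_cases hx : x = 0 <;> by_cases hy : y = 0 <;> simp [hx, hy]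
  rw [sum_filter, Fintype.sum_prod_type]
  simp only [key, sum_sub_distrib, sum_add_distrib, sum_ite_eq', mem_univ, if_true]
  congr 1
  · congr 1
    rw [sum_comm]
    simp
  · rw [sum_comm]
    simp

lemma card_mul_eq (t : F) (ht : t ≠ 0) :
    (#(univ.filter (fun η : F × F => η.1 * η.2 = t)) : ℝ) = Fintype.card F - 1 := by
  have h : #(univ.filter (fun η : F × F => η.1 * η.2 = t)) = #(univ.erase (0 : F)) := by
    refine card_nbij' Prod.fst (fun x => (x, t / x)) ?_ ?_ ?_ ?_
    · rintro ⟨x, y⟩ h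
      simp at h ⊢
      grind
    · intro x h
      simp at h ⊢
      grind
    · rintro ⟨x, y⟩ h
      simp at h ⊢
      grind
    · intro x h
      rfl
  rw [h, card_erase_of_mem (mem_univ _), card_univ, Nat.cast_sub Fintype.card_pos, Nat.cast_one]

/-- Cauchy–Schwarz on a line with its centre removed. -/
lemma sq_sum_sub_zero_le (φ : F → ℝ) :
    (∑ a, φ a - φ 0) ^ 2 ≤ ((Fintype.card F : ℝ) - 1) * (∑ a, φ a ^ 2 - φ 0 ^ 2) := by
  have h := sq_sum_le_card_mul_sum_sq (s := univ.erase (0 : F)) (f := φ)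
  rwa [card_erase_of_mem (mem_univ _), card_univ, Nat.cast_sub Fintype.card_pos, Nat.cast_one,
    sum_erase_eq_sub (mem_univ _), sum_erase_eq_sub (mem_univ _)] at h

/-- The contribution of a single centre, bounded by Cauchy–Schwarz on each hyperbola and on each
of the two isotropic lines. -/
lemma sum_sq_sum_hyperbola_le (G : F × F → ℝ) :
    ∑ t : F, (∑ η ∈ univ.filter (fun η : F × F => η.1 * η.2 = t), G η) ^ 2 ≤
      ((Fintype.card F : ℝ) - 1) * ∑ η, G η ^ 2 - Fintype.card F * G (0, 0) ^ 2 +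
        2 * ((∑ a, G (a, 0)) * ∑ b, G (0, b)) := by
  have hsplit : ∑ η, G η ^ 2 =
      ∑ t : F, ∑ η ∈ univ.filter (fun η : F × F => η.1 * η.2 = t), G η ^ 2 :=
    (sum_fiberwise univ _ _).symm
  rw [← add_sum_erase _ _ (mem_univ (0 : F))] at hsplit ⊢
  rw [sum_mul_eq_zero] at hsplit ⊢
  have hne : ∑ t ∈ univ.erase (0 : F),
      (∑ η ∈ univ.filter (fun η : F × F => η.1 * η.2 = t), G η) ^ 2 ≤
      ((Fintype.card F : ℝ) - 1) * ∑ t ∈ univ.erase (0 : F),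
        ∑ η ∈ univ.filter (fun η : F × F => η.1 * η.2 = t), G η ^ 2 := by
    rw [mul_sum]
    refine sum_le_sum fun t ht => ?_
    rw [← card_mul_eq t (ne_of_mem_erase ht)]
    exact sq_sum_le_card_mul_sum_sq
  have hrow := sq_sum_sub_zero_le (fun a => G (a, 0))
  have hcol := sq_sum_sub_zero_le (fun b => G (0, b))
  rw [hsplit]
  linear_combination hne + hrow + hcol

lemma sum_mul_reflection_le {ι : Type*} [AddCommGroup ι] [Fintype ι] (φ : ι → ℝ) (x : ι) :
    ∑ a, φ (x + a) * φ (x - a) ≤ ∑ a, φ a ^ 2 := by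
  have h1 : ∑ a, φ (x + a) ^ 2 = ∑ a, φ a ^ 2 :=
    Equiv.sum_comp (Equiv.addLeft x) (fun a => φ a ^ 2)
  have h2 : ∑ a, φ (x - a) ^ 2 = ∑ a, φ a ^ 2 :=
    Equiv.sum_comp (Equiv.subLeft x) (fun a => φ a ^ 2)
  have h3 : ∑ a, 2 * (φ (x + a) * φ (x - a)) ≤ ∑ a, (φ (x + a) ^ 2 + φ (x - a) ^ 2) :=
    sum_le_sum fun a _ => by linarith [two_mul_le_add_sq (φ (x + a)) (φ (x - a))]
  rw [← mul_sum, sum_add_distrib] at h3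
  linarith

lemma sum_sum_sq_sum_hyperbola_le (h2 : (2 : F) ≠ 0) (g : F × F → ℝ) (hg : ∀ x, 0 ≤ g x) :
    ∑ m : F × F, ∑ t : F,
      (∑ η ∈ univ.filter (fun η : F × F => η.1 * η.2 = t), g (m + η) * g (m - η)) ^ 2 ≤
      ((Fintype.card F : ℝ) + 1 - 1 / Fintype.card F) * (∑ x, g x ^ 2) ^ 2 := by
  have hq : (0 : ℝ) < Fintype.card F := Nat.cast_pos.mpr Fintype.card_pos
  have hcenter := sum_le_sum fun (m : F × F) (_ : m ∈ univ) =>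
    sum_sq_sum_hyperbola_le (fun η => g (m + η) * g (m - η))
  have hall := sum_sum_mul_reflection h2 (fun x => g x ^ 2)
  have hlines : ∑ m : F × F, (∑ a, g (m + (a, 0)) * g (m - (a, 0))) *
      ∑ b, g (m + (0, b)) * g (m - (0, b)) ≤ (∑ x, g x ^ 2) ^ 2 := by
    calc _ ≤ ∑ m : F × F, (∑ a, g (a, m.2) ^ 2) * ∑ b, g (m.1, b) ^ 2 := by
          refine sum_le_sum fun m _ => mul_le_mul ?_ ?_ ?_ ?_
          · simpa [Prod.add_def, Prod.sub_def] using
              sum_mul_reflection_le (fun a => g (a, m.2)) m.1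
          · simpa [Prod.add_def, Prod.sub_def] using
              sum_mul_reflection_le (fun b => g (m.1, b)) m.2
          · exact sum_nonneg fun b _ => mul_nonneg (hg _) (hg _)
          · exact sum_nonneg fun b _ => sq_nonneg _
      _ = (∑ x, g x ^ 2) ^ 2 := by
          rw [Fintype.sum_prod_type, sum_comm, sq]
          nth_rewrite 2 [Fintype.sum_prod_type]
          rw [Fintype.sum_prod_type_right, sum_mul_sum]
  have hdiag : (∑ x, g x ^ 2) ^ 2 ≤ (Fintype.card F : ℝ) ^ 2 * ∑ x, (g x ^ 2) ^ 2 := by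
    have h := sq_sum_le_card_mul_sum_sq (s := univ) (f := fun x => g x ^ 2)
    rwa [card_univ, Fintype.card_prod, Nat.cast_mul, ← sq] at h
  have hdiag' : 1 / Fintype.card F * (∑ x, g x ^ 2) ^ 2 ≤
      Fintype.card F * ∑ x, (g x ^ 2) ^ 2 := by
    rw [one_div, inv_mul_le_iff₀ hq]
    linarith
  simp only [mul_pow, sum_add_distrib, sum_sub_distrib, ← mul_sum, Prod.mk_zero_zero, add_zero,
    sub_zero, hall] at hcenter
  have hfour : ∑ x, g x ^ 2 * g x ^ 2 = ∑ x, (g x ^ 2) ^ 2 :=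
    sum_congr rfl fun x _ => (sq _).symm
  rw [hfour] at hcenter
  linarith

lemma sum_sq_card_hyperbola :
    ∑ t : F, (#(univ.filter (fun η : F × F => η.1 * η.2 = t)) : ℝ) ^ 2 =
      (2 * Fintype.card F - 1) ^ 2 + (Fintype.card F - 1) ^ 3 := by
  have h0 : (#(univ.filter (fun η : F × F => η.1 * η.2 = 0)) : ℝ) = 2 * Fintype.card F - 1 := by
    have h := sum_mul_eq_zero (F := F) (fun _ => 1)
    simp only [sum_const, card_univ, nsmul_eq_mul, mul_one] at h
    rw [h]
    ring
  rw [← add_sum_erase _ _ (mem_univ (0 : F)), h0,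
    sum_congr rfl fun t ht => by rw [card_mul_eq t (ne_of_mem_erase ht)], sum_const,
    card_erase_of_mem (mem_univ _), card_univ, nsmul_eq_mul, Nat.cast_sub Fintype.card_pos,
    Nat.cast_one]
  ring

end HyperbolicParaboloid

/-- Sharp L²→L⁴ extension inequality from the hyperbolic paraboloid H² ⊂ F³
in combinatorial form, with equality for constant functions. -/
theorem hyperbolic_paraboloid_sharp_L2_L4_extension
    (p n q : ℕ) (hp : p.Prime) (hp2 : p ≠ 2) (hn : 0 < n) (hq : q = p ^ n)
    (F : Type) [Field F] [Fintype F] [DecidableEq F] (hF : Fintype.card F = q)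
    (f : F × F → ℂ) :
    (∑ ξτ : (F × F) × F,
        ‖∑ y ∈ univ.filter (fun y : (F × F) × (F × F) =>
            y.1 + y.2 = ξτ.1 ∧
            (y.1.1 ^ 2 - y.1.2 ^ 2) + (y.2.1 ^ 2 - y.2.2 ^ 2) = ξτ.2),
          f y.1 * f y.2‖ ^ 2)
      ≤ ((q : ℝ) + 1 - 1 / q) * (∑ ξ : F × F, ‖f ξ‖ ^ 2) ^ 2
    ∧ (∀ c : ℂ, (∀ ξ, f ξ = c) →
      (∑ ξτ : (F × F) × F,
        ‖∑ y ∈ univ.filter (fun y : (F × F) × (F × F) =>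
            y.1 + y.2 = ξτ.1 ∧
            (y.1.1 ^ 2 - y.1.2 ^ 2) + (y.2.1 ^ 2 - y.2.2 ^ 2) = ξτ.2),
          f y.1 * f y.2‖ ^ 2)
      = ((q : ℝ) + 1 - 1 / q) * (∑ ξ : F × F, ‖f ξ‖ ^ 2) ^ 2) := by
  have h2 : (2 : F) ≠ 0 := by
    have : Fact p.Prime := ⟨hp⟩
    have : CharP F p := charP_of_card_eq_prime_pow (hF.trans hq)
    exact Ring.two_ne_zero (by rwa [ringChar.eq F p])
  rw [sum_norm_sq_eq_sum_center h2, ← hF]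
  refine ⟨?_, fun c hc => ?_⟩
  · rw [← sum_isotropic_coordinates h2 (fun x => ‖f x‖ ^ 2)]
    refine le_trans ?_ (sum_sum_sq_sum_hyperbola_le h2 (fun x => ‖f (x.1 + x.2, x.1 - x.2)‖)
      fun _ => norm_nonneg _)
    refine sum_le_sum fun m _ => sum_le_sum fun t _ => pow_le_pow_left₀ (norm_nonneg _) ?_ 2
    exact (norm_sum_le _ _).trans_eq (sum_congr rfl fun _ _ => norm_mul _ _)
  · have hq0 : (Fintype.card F : ℝ) ≠ 0 := Nat.cast_ne_zero.mpr Fintype.card_ne_zero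
    simp only [hc, sum_const, nsmul_eq_mul, norm_mul, mul_pow, Complex.norm_natCast, ← sum_mul,
      sum_sq_card_hyperbola, card_univ, Fintype.card_prod, Nat.cast_mul]
    field_simp
    ring
end

section
/- Let p be an odd prime, n a positive integer, q = p^n, and let F be a finite field with exactly q elements. Let Tr : F → ZMod p denote the field trace. For ξ = (ξ₁,ξ₂) ∈ F², write ξ⊙ξ = ξ₁² − ξ₂². A function f : F² → ℂ that is not identically zero attains equality in ∑_{(ξ,τ) ∈ F²×F} | ∑_{ξ₁+ξ₂=ξ, ξ₁⊙ξ₁+ξ₂⊙ξ₂=τ} f(ξ₁)f(ξ₂) |² ≤ (q + 1 − 1/q)·(∑_{ξ∈F²}|f(ξ)|²)² if and only if there exist λ ∈ ℂ \ {0} and a, b, c ∈ F such that for all η, ζ ∈ F, f(η + ζ, η − ζ) = λ · exp(2πi·t/p), where t ∈ {0,…,p−1} is the canonical representative of Tr(aη + bζ + cηζ) ∈ ZMod p. -/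
open Finset

/-- The amount by which the Cauchy–Schwarz bound `‖∑ u‖² ≤ #s ∑ ‖u‖²` fails to be sharp. -/
noncomputable def cauchySchwarzDeficit {ι E : Type*} [NormedAddCommGroup E]
    (s : Finset ι) (u : ι → E) : ℝ :=
  #s * ∑ i ∈ s, ‖u i‖ ^ 2 - ‖∑ i ∈ s, u i‖ ^ 2

section Deficit

variable {ι E : Type*} [NormedAddCommGroup E] [InnerProductSpace ℝ E]

theorem sum_sum_norm_sub_sq (s : Finset ι) (u : ι → E) :
    ∑ i ∈ s, ∑ j ∈ s, ‖u i - u j‖ ^ 2 = 2 * cauchySchwarzDeficit s u := by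
  have h : ‖∑ i ∈ s, u i‖ ^ 2 = ∑ i ∈ s, ∑ j ∈ s, inner ℝ (u i) (u j) := by
    rw [← real_inner_self_eq_norm_sq, sum_inner]
    simp_rw [inner_sum]
  simp only [cauchySchwarzDeficit, h, norm_sub_sq_real, sum_add_distrib, sum_sub_distrib,
    sum_const, ← mul_sum, nsmul_eq_mul]
  ring

theorem cauchySchwarzDeficit_nonneg (s : Finset ι) (u : ι → E) :
    0 ≤ cauchySchwarzDeficit s u := by
  have h : 0 ≤ ∑ i ∈ s, ∑ j ∈ s, ‖u i - u j‖ ^ 2 := by positivity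
  rw [sum_sum_norm_sub_sq] at h
  linarith

theorem cauchySchwarzDeficit_eq_zero_iff (s : Finset ι) (u : ι → E) :
    cauchySchwarzDeficit s u = 0 ↔ ∀ i ∈ s, ∀ j ∈ s, u i = u j := by
  have h := sum_sum_norm_sub_sq s u
  have h' : cauchySchwarzDeficit s u = 0 ↔ ∑ i ∈ s, ∑ j ∈ s, ‖u i - u j‖ ^ 2 = 0 := by
    rw [h]; simp
  rw [h', sum_eq_zero_iff_of_nonneg (fun i _ => by positivity)]
  refine forall₂_congr fun i _ => ?_
  rw [sum_eq_zero_iff_of_nonneg (fun i _ => by positivity)]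
  simp [sub_eq_zero]

end Deficit

section Hyperbola

variable {F : Type*} [Field F] [Fintype F] [DecidableEq F]

theorem card_filter_mul_eq {t : F} (ht : t ≠ 0) :
    #{h : F × F | h.1 * h.2 = t} = #(univ.erase (0 : F)) := by
  refine card_nbij' (fun h => h.1) (fun s => (s, t / s)) ?_ ?_ ?_ ?_
  · intro h hh
    simp only [coe_filter, mem_univ, true_and, Set.mem_ofPred_eq] at hh
    simp only [coe_erase, coe_univ, Set.mem_sdiff, Set.mem_univ, Set.mem_singleton_iff, true_and]
    rintro h0
    exact ht (by rw [← hh, h0, zero_mul])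
  · intro s hs
    simp only [coe_erase, coe_univ, Set.mem_sdiff, Set.mem_univ, Set.mem_singleton_iff,
      true_and] at hs
    simp only [coe_filter, mem_univ, true_and, Set.mem_ofPred_eq]
    field_simp
  · intro h hh
    simp only [coe_filter, mem_univ, true_and, Set.mem_ofPred_eq] at hh
    have h0 : h.1 ≠ 0 := fun h0 => ht (by rw [← hh, h0, zero_mul])
    ext
    · rfl
    · simp [← hh, h0]
  · intro s _
    rfl

theorem sum_filter_mul_eq_zero {M : Type*} [AddCommMonoid M] (u : F × F → M) :
    ∑ h : F × F with h.1 * h.2 = 0, u h =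
      ∑ s ∈ univ.erase 0, u (s, 0) + ∑ s ∈ univ.erase 0, u (0, s) + u (0, 0) := by
  have h : ∀ i : F, ∑ j, (if i * j = 0 then u (i, j) else 0) =
      if i = 0 then ∑ j, u (0, j) else u (i, 0) := by
    intro i
    by_cases hi : i = 0
    · simp [hi]
    · simp [hi]
  rw [sum_filter, Fintype.sum_prod_type]
  simp only [h]
  rw [← sum_erase_add univ _ (mem_univ (0 : F)), if_pos rfl,
    ← sum_erase_add univ (fun j => u (0, j)) (mem_univ (0 : F)), ← add_assoc]
  congr 2
  exact sum_congr rfl fun i hi => if_neg (ne_of_mem_erase hi)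

/-- The exact loss in bounding the `L²` norm of the pushforward of `u` under multiplication
by Cauchy–Schwarz on every hyperbola and on the punctured axes. -/
noncomputable def hyperbolaDeficit (u : F × F → ℂ) : ℝ :=
  ∑ t ∈ univ.erase (0 : F), cauchySchwarzDeficit {h : F × F | h.1 * h.2 = t} u +
    cauchySchwarzDeficit (univ.erase (0 : F)) (fun s => u (s, 0)) +
    cauchySchwarzDeficit (univ.erase (0 : F)) (fun s => u (0, s))

theorem hyperbolaDeficit_nonneg (u : F × F → ℂ) : 0 ≤ hyperbolaDeficit u :=
  add_nonneg (add_nonneg (sum_nonneg fun _ _ => cauchySchwarzDeficit_nonneg _ _)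
    (cauchySchwarzDeficit_nonneg _ _)) (cauchySchwarzDeficit_nonneg _ _)

theorem sum_norm_sq_sum_filter_mul_eq (u : F × F → ℂ) :
    ∑ t : F, ‖∑ h : F × F with h.1 * h.2 = t, u h‖ ^ 2 =
      ((Fintype.card F : ℝ) - 1) * ∑ h, ‖u h‖ ^ 2 - Fintype.card F * ‖u 0‖ ^ 2 +
        2 * inner ℝ (∑ s, u (s, 0)) (∑ s, u (0, s)) - hyperbolaDeficit u := by
  have hcard : (#(univ.erase (0 : F)) : ℝ) = (Fintype.card F : ℝ) - 1 := by
    rw [card_erase_of_mem (mem_univ _), card_univ, Nat.cast_sub Fintype.card_pos, Nat.cast_one]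
  have htotal : ∑ h, ‖u h‖ ^ 2 =
      ∑ t ∈ univ.erase (0 : F), ∑ h : F × F with h.1 * h.2 = t, ‖u h‖ ^ 2 +
        (∑ s ∈ univ.erase (0 : F), ‖u (s, 0)‖ ^ 2 + ∑ s ∈ univ.erase (0 : F), ‖u (0, s)‖ ^ 2
          + ‖u (0, 0)‖ ^ 2) := by
    rw [← sum_filter_mul_eq_zero (fun h => ‖u h‖ ^ 2), sum_erase_add _ _ (mem_univ _),
      sum_fiberwise]
  have hD : ∑ t ∈ univ.erase (0 : F), cauchySchwarzDeficit {h : F × F | h.1 * h.2 = t} u =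
      ((Fintype.card F : ℝ) - 1) *
        ∑ t ∈ univ.erase (0 : F), ∑ h : F × F with h.1 * h.2 = t, ‖u h‖ ^ 2 -
      ∑ t ∈ univ.erase (0 : F), ‖∑ h : F × F with h.1 * h.2 = t, u h‖ ^ 2 := by
    rw [mul_sum, ← sum_sub_distrib]
    refine sum_congr rfl fun t ht => ?_
    rw [cauchySchwarzDeficit, card_filter_mul_eq (ne_of_mem_erase ht), hcard]
  rw [hyperbolaDeficit, hD, htotal, cauchySchwarzDeficit, cauchySchwarzDeficit, hcard,
    ← sum_erase_add univ _ (mem_univ (0 : F)), sum_filter_mul_eq_zero,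
    ← sum_erase_add univ (fun s => u (s, 0)) (mem_univ (0 : F)),
    ← sum_erase_add univ (fun s => u (0, s)) (mem_univ (0 : F))]
  simp only [← real_inner_self_eq_norm_sq (∑ s ∈ univ.erase (0 : F), u _),
    ← real_inner_self_eq_norm_sq (_ + _ : ℂ), inner_add_left, inner_add_right, Prod.mk_zero_zero,
    real_inner_self_eq_norm_sq (u _)]
  rw [real_inner_comm (∑ s ∈ univ.erase (0 : F), u (s, 0)) (∑ s ∈ univ.erase (0 : F), u (0, s)),
    real_inner_comm (u 0) (∑ s ∈ univ.erase (0 : F), u (0, s)),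
    real_inner_comm (u 0) (∑ s ∈ univ.erase (0 : F), u (s, 0))]
  ring

end Hyperbola

section Energy

variable {F : Type*} [Field F]

theorem bijective_add_sub_s6 {V : Type*} [AddCommGroup V] [Module F V] [Finite V]
    (h2 : (2 : F) ≠ 0) :
    Function.Bijective (fun y : V × V => (y.1 + y.2, y.1 - y.2)) := by
  refine Finite.injective_iff_bijective.mp ?_
  have hinj : ∀ v w : V, v + v = w + w → v = w := by
    intro v w h
    rw [← two_smul F v, ← two_smul F w] at h
    exact smul_right_injective V h2 h
  rintro ⟨x, h⟩ ⟨x', h'⟩ he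
  simp only [Prod.mk.injEq] at he ⊢
  obtain ⟨ha, hs⟩ := he
  refine ⟨hinj _ _ ?_, hinj _ _ ?_⟩
  · calc x + x = (x + h) + (x - h) := by abel
      _ = x' + x' := by rw [ha, hs]; abel
  · calc h + h = (x + h) - (x - h) := by abel
      _ = h' + h' := by rw [ha, hs]; abel

variable [Fintype F]

theorem sum_sum_mul_add_sub (h2 : (2 : F) ≠ 0) (φ : F × F → ℝ) :
    ∑ x, ∑ h, φ (x + h) * φ (x - h) = (∑ x, φ x) ^ 2 := by
  rw [sq, sum_mul_sum, ← Fintype.sum_prod_type', ← Fintype.sum_prod_type']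
  exact Fintype.sum_bijective _ (bijective_add_sub_s6 h2) _ _ fun _ => rfl

/-- The product of the values of `g` at the two points symmetric about `x` with offset `h`. -/
def symmetricProduct (g : F × F → ℂ) (x h : F × F) : ℂ := g (x + h) * g (x - h)

theorem norm_sum_symmetricProduct_row_le (g : F × F → ℂ) (x : F × F) :
    ‖∑ s, symmetricProduct g x (s, 0)‖ ≤ ∑ s, ‖g (s, x.2)‖ ^ 2 := by
  have h₁ : ∑ s, ‖g (x + (s, 0))‖ ^ 2 = ∑ s, ‖g (s, x.2)‖ ^ 2 :=
    Fintype.sum_equiv (Equiv.addLeft x.1) _ _ fun s => by simp [Prod.add_def]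
  have h₂ : ∑ s, ‖g (x - (s, 0))‖ ^ 2 = ∑ s, ‖g (s, x.2)‖ ^ 2 :=
    Fintype.sum_equiv (Equiv.subLeft x.1) _ _ fun s => by simp [Prod.sub_def]
  calc ‖∑ s, symmetricProduct g x (s, 0)‖
      ≤ ∑ s, ‖symmetricProduct g x (s, 0)‖ := norm_sum_le _ _
    _ ≤ ∑ s, (‖g (x + (s, 0))‖ ^ 2 + ‖g (x - (s, 0))‖ ^ 2) / 2 := by
        refine sum_le_sum fun s _ => ?_
        rw [symmetricProduct, norm_mul]
        linarith [two_mul_le_add_sq ‖g (x + (s, 0))‖ ‖g (x - (s, 0))‖]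
    _ = ∑ s, ‖g (s, x.2)‖ ^ 2 := by
        rw [← sum_div, sum_add_distrib, h₁, h₂]
        ring

theorem norm_sum_symmetricProduct_col_le (g : F × F → ℂ) (x : F × F) :
    ‖∑ s, symmetricProduct g x (0, s)‖ ≤ ∑ s, ‖g (x.1, s)‖ ^ 2 := by
  refine le_of_eq_of_le ?_ (norm_sum_symmetricProduct_row_le (g ∘ Prod.swap) x.swap)
  simp [symmetricProduct]

/-- The loss at `x` in bounding the interaction of the two lines through `x` by the product of
the squared `L²` norms of `g` on these lines. -/
noncomputable def crossDeficit (g : F × F → ℂ) (x : F × F) : ℝ :=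
  (∑ s, ‖g (s, x.2)‖ ^ 2) * (∑ s, ‖g (x.1, s)‖ ^ 2) -
    inner ℝ (∑ s, symmetricProduct g x (s, 0)) (∑ s, symmetricProduct g x (0, s))

theorem crossDeficit_nonneg (g : F × F → ℂ) (x : F × F) : 0 ≤ crossDeficit g x := by
  refine sub_nonneg.mpr ((real_inner_le_norm _ _).trans ?_)
  exact mul_le_mul (norm_sum_symmetricProduct_row_le g x) (norm_sum_symmetricProduct_col_le g x)
    (norm_nonneg _) (by positivity)

theorem sum_crossDeficit (g : F × F → ℂ) :
    ∑ x, crossDeficit g x = (∑ x, ‖g x‖ ^ 2) ^ 2 -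
      ∑ x, inner ℝ (∑ s, symmetricProduct g x (s, 0)) (∑ s, symmetricProduct g x (0, s)) := by
  simp only [crossDeficit, sum_sub_distrib]
  congr 1
  rw [Fintype.sum_prod_type, sq]
  nth_rewrite 2 [Fintype.sum_prod_type_right]
  rw [Fintype.sum_prod_type, sum_mul_sum]
  exact sum_congr rfl fun i _ => sum_congr rfl fun j _ => mul_comm _ _

variable [DecidableEq F]

/-- The exact deficit in the sharp inequality for the hyperbolic energy of `g`. -/
noncomputable def energyDeficit (g : F × F → ℂ) : ℝ :=
  ∑ x, hyperbolaDeficit (symmetricProduct g x) + 2 * ∑ x, crossDeficit g x +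
    cauchySchwarzDeficit univ (fun x => ‖g x‖ ^ 2) / Fintype.card F

theorem energy_eq_sub_energyDeficit (h2 : (2 : F) ≠ 0) (g : F × F → ℂ) :
    ∑ x, ∑ t, ‖∑ h : F × F with h.1 * h.2 = t, symmetricProduct g x h‖ ^ 2 =
      ((Fintype.card F : ℝ) + 1 - 1 / Fintype.card F) * (∑ x, ‖g x‖ ^ 2) ^ 2 -
        energyDeficit g := by
  have hq : (Fintype.card F : ℝ) ≠ 0 := by simp
  have h₁ : ∑ x, ∑ h, ‖symmetricProduct g x h‖ ^ 2 = (∑ x, ‖g x‖ ^ 2) ^ 2 := by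
    rw [← sum_sum_mul_add_sub h2]
    simp only [symmetricProduct, norm_mul, mul_pow]
  have h₂ : cauchySchwarzDeficit univ (fun x => ‖g x‖ ^ 2) =
      (Fintype.card F : ℝ) ^ 2 * ∑ x, ‖symmetricProduct g x 0‖ ^ 2 -
        (∑ x, ‖g x‖ ^ 2) ^ 2 := by
    simp only [cauchySchwarzDeficit, symmetricProduct, card_univ, Fintype.card_prod, Nat.cast_mul,
      Real.norm_eq_abs, sq_abs, add_zero, sub_zero, norm_mul]
    congr 2
    · ring
    · exact sum_congr rfl fun x _ => by ring
  simp only [sum_norm_sq_sum_filter_mul_eq, sum_add_distrib, sum_sub_distrib, ← mul_sum, h₁]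
  rw [energyDeficit, sum_crossDeficit, h₂]
  field_simp
  ring

theorem energyDeficit_eq_zero_iff (g : F × F → ℂ) :
    energyDeficit g = 0 ↔ (∀ x y, ‖g x‖ = ‖g y‖) ∧ ∀ x h h' : F × F, h.1 * h.2 = h'.1 * h'.2 →
      symmetricProduct g x h = symmetricProduct g x h' := by
  have hq : 0 < (Fintype.card F : ℝ) := by exact_mod_cast Fintype.card_pos
  have n₁ : ∀ x ∈ univ, 0 ≤ hyperbolaDeficit (symmetricProduct g x) :=
    fun x _ => hyperbolaDeficit_nonneg _
  have n₂ : ∀ x ∈ univ, 0 ≤ crossDeficit g x := fun x _ => crossDeficit_nonneg g x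
  have n₃ := div_nonneg (cauchySchwarzDeficit_nonneg univ (fun x => ‖g x‖ ^ 2)) hq.le
  have n₄ := sum_nonneg n₁
  have n₅ := sum_nonneg n₂
  have hzero : energyDeficit g = 0 ↔ (∀ x, hyperbolaDeficit (symmetricProduct g x) = 0) ∧
      (∀ x, crossDeficit g x = 0) ∧ ∀ x y, ‖g x‖ = ‖g y‖ := by
    rw [energyDeficit, add_eq_zero_iff_of_nonneg (by positivity) n₃,
      add_eq_zero_iff_of_nonneg n₄ (by positivity), mul_eq_zero, div_eq_zero_iff,
      sum_eq_zero_iff_of_nonneg n₁, sum_eq_zero_iff_of_nonneg n₂,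
      cauchySchwarzDeficit_eq_zero_iff, and_assoc]
    simp [hq.ne']
  rw [hzero]
  constructor
  · rintro ⟨hhyp, hcross, hnorm⟩
    refine ⟨hnorm, fun x => ?_⟩
    have haxes : ∀ s, symmetricProduct g x (s, 0) = symmetricProduct g x 0 ∧
        symmetricProduct g x (0, s) = symmetricProduct g x 0 := by
      set A := ∑ s, symmetricProduct g x (s, 0) with hA
      set B := ∑ s, symmetricProduct g x (0, s) with hB
      have hc := hcross x
      have hAle := norm_sum_symmetricProduct_row_le g x
      have hBle := norm_sum_symmetricProduct_col_le g x
      rw [crossDeficit] at hc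
      simp only [fun y => hnorm y x, sum_const, card_univ, nsmul_eq_mul, ← hA, ← hB]
        at hc hAle hBle
      set r := (Fintype.card F : ℝ) * ‖g x‖ ^ 2
      have hAB := real_inner_le_norm A B
      have hA0 := norm_nonneg A
      have hB0 := norm_nonneg B
      have hAr : ‖A‖ = r := by
        refine le_antisymm hAle ?_
        by_contra! hlt
        nlinarith
      have hBr : ‖B‖ = r := by
        refine le_antisymm hBle ?_
        by_contra! hlt
        nlinarith
      have hGn : ∀ h, ‖symmetricProduct g x h‖ = ‖g x‖ ^ 2 := fun h => by
        rw [symmetricProduct, norm_mul, hnorm _ x, hnorm (x - h) x, sq]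
      have hrow : cauchySchwarzDeficit univ (fun s => symmetricProduct g x (s, 0)) = 0 := by
        rw [cauchySchwarzDeficit, ← hA, hAr]
        simp only [hGn, sum_const, card_univ, nsmul_eq_mul, r]
        ring
      have hcol : cauchySchwarzDeficit univ (fun s => symmetricProduct g x (0, s)) = 0 := by
        rw [cauchySchwarzDeficit, ← hB, hBr]
        simp only [hGn, sum_const, card_univ, nsmul_eq_mul, r]
        ring
      rw [cauchySchwarzDeficit_eq_zero_iff] at hrow hcol
      exact fun s => ⟨hrow s (mem_univ _) 0 (mem_univ _), hcol s (mem_univ _) 0 (mem_univ _)⟩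
    have hzero : ∀ h : F × F, h.1 * h.2 = 0 →
        symmetricProduct g x h = symmetricProduct g x 0 := by
      rintro ⟨s, t⟩ h
      rcases mul_eq_zero.mp h with h | h <;> simp only at h <;> subst h
      · exact (haxes t).2
      · exact (haxes s).1
    intro h h' hh
    by_cases h0 : h.1 * h.2 = 0
    · rw [hzero h h0, hzero h' (hh ▸ h0)]
    · have hx := hhyp x
      have m₁ := fun t (_ : t ∈ univ.erase (0 : F)) =>
        cauchySchwarzDeficit_nonneg {h : F × F | h.1 * h.2 = t} (symmetricProduct g x)
      have m₂ := cauchySchwarzDeficit_nonneg (univ.erase (0 : F))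
        (fun s => symmetricProduct g x (s, 0))
      have m₃ := cauchySchwarzDeficit_nonneg (univ.erase (0 : F))
        (fun s => symmetricProduct g x (0, s))
      rw [hyperbolaDeficit, add_eq_zero_iff_of_nonneg (add_nonneg (sum_nonneg m₁) m₂) m₃,
        add_eq_zero_iff_of_nonneg (sum_nonneg m₁) m₂, sum_eq_zero_iff_of_nonneg m₁] at hx
      have ht := hx.1.1 (h.1 * h.2) (mem_erase.mpr ⟨h0, mem_univ _⟩)
      rw [cauchySchwarzDeficit_eq_zero_iff] at ht
      exact ht h (by simp) h' (by simp [hh])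
  · rintro ⟨hnorm, hconst⟩
    refine ⟨fun x => ?_, fun x => ?_, hnorm⟩
    · rw [hyperbolaDeficit, sum_eq_zero, (cauchySchwarzDeficit_eq_zero_iff _ _).mpr,
        (cauchySchwarzDeficit_eq_zero_iff _ _).mpr]
      · simp
      · exact fun i _ j _ => hconst x _ _ (by simp)
      · exact fun i _ j _ => hconst x _ _ (by simp)
      · intro t _
        rw [cauchySchwarzDeficit_eq_zero_iff]
        intro i hi j hj
        simp only [mem_filter, mem_univ, true_and] at hi hj
        exact hconst x _ _ (hi.trans hj.symm)
    · have hrow : ∀ s, symmetricProduct g x (s, 0) = g x * g x := fun s => by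
        rw [hconst x (s, 0) 0 (by simp), symmetricProduct, add_zero, sub_zero]
      have hcol : ∀ s, symmetricProduct g x (0, s) = g x * g x := fun s => by
        rw [hconst x (0, s) 0 (by simp), symmetricProduct, add_zero, sub_zero]
      rw [crossDeficit]
      simp only [hrow, hcol, fun y => hnorm y x, real_inner_self_eq_norm_sq, sum_const, card_univ,
        nsmul_eq_mul, norm_mul, Complex.norm_natCast]
      ring

end Energy

section Characters

variable {F : Type*} [Field F]

theorem exists_addChar_of_mul_add_sub (h2 : (2 : F) ≠ 0) {φ : F → ℂ} (h0 : φ 0 ≠ 0)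
    (h : ∀ u s, φ (u + s) * φ (u - s) = φ u ^ 2) :
    ∃ ψ : AddChar F ℂ, ∀ u, φ u = φ 0 * ψ u := by
  have hmul : ∀ a b, φ a * φ b = φ (a + b) * φ 0 := by
    intro a b
    have e₁ := h ((a + b) / 2) ((a - b) / 2)
    have e₂ := h ((a + b) / 2) ((a + b) / 2)
    rw [← e₂] at e₁
    convert e₁ using 3 <;> field_simp <;> ring
  refine ⟨⟨fun u => φ u / φ 0, div_self h0, fun a b => ?_⟩, fun u => ?_⟩
  · rw [div_mul_div_comm, hmul]
    field_simp
  · simp only [AddChar.coe_mk]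
    field_simp

theorem exists_addChar_of_symmetricProduct_eq (h2 : (2 : F) ≠ 0) {g : F × F → ℂ}
    (h0 : ∀ x, g x ≠ 0)
    (hconst : ∀ x h h' : F × F, h.1 * h.2 = h'.1 * h'.2 →
      symmetricProduct g x h = symmetricProduct g x h') :
    ∃ α β χ : AddChar F ℂ, ∀ s t, g (s, t) = g 0 * (α s * β t * χ (s * t)) := by
  have hrow : ∀ t, ∃ α : AddChar F ℂ, ∀ s, g (s, t) = g (0, t) * α s := fun t =>
    exists_addChar_of_mul_add_sub (φ := fun s => g (s, t)) h2 (h0 _) fun u s => by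
      simpa [symmetricProduct, sq] using hconst (u, t) (s, 0) 0 (by simp)
  have hcol : ∀ s, ∃ β : AddChar F ℂ, ∀ t, g (s, t) = g (s, 0) * β t := fun s =>
    exists_addChar_of_mul_add_sub (φ := fun t => g (s, t)) h2 (h0 _) fun u t => by
      simpa [symmetricProduct, sq] using hconst (s, u) (0, t) 0 (by simp)
  choose α hα using hrow
  choose β hβ using hcol
  set D : F → F → ℂ := fun s t => (α t * (α 0)⁻¹) s with hD
  have hne : ∀ (ψ : AddChar F ℂ) s, ψ s ≠ 0 := fun ψ s => (ψ.val_isUnit s).ne_zero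
  have hg : ∀ s t, g (s, t) = g 0 * (α 0 s * β 0 t * D s t) := by
    intro s t
    have e : (α 0 * (α 0)⁻¹) s = 1 := by rw [mul_inv_cancel, AddChar.one_apply]
    rw [AddChar.mul_apply] at e
    rw [hα t s, hβ 0 t, hD]
    simp only [AddChar.mul_apply, Prod.mk_zero_zero]
    linear_combination (-g 0 * β 0 t * α t s) * e
  have hD' : ∀ s t, D s t = (β s * (β 0)⁻¹) t := by
    intro s t
    have e : (β 0 * (β 0)⁻¹) t = 1 := by rw [mul_inv_cancel, AddChar.one_apply]
    rw [AddChar.mul_apply] at e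
    have e₁ := hg s t
    rw [hβ s t, hα 0 s, Prod.mk_zero_zero] at e₁
    have e₂ : β s t = β 0 t * D s t :=
      mul_left_cancel₀ (mul_ne_zero (h0 0) (hne (α 0) s)) (by rw [e₁]; ring)
    rw [AddChar.mul_apply, e₂]
    linear_combination (-D s t) * e
  have hsq : ∀ s t, g (s, t) * g (-s, -t) = g 0 ^ 2 * D (s + s) t := by
    intro s t
    have a := (α 0).map_add_eq_mul s (-s)
    have b := (β 0).map_add_eq_mul t (-t)
    have d : D (-s) (-t) = D s t := by
      have e₁ : D (-s) (-t) * D (-s) t = 1 := by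
        rw [hD', hD', ← AddChar.map_add_eq_mul, neg_add_cancel, AddChar.map_zero_eq_one]
      have e₂ : D s t * D (-s) t = 1 := by
        rw [hD]
        simp only
        rw [← AddChar.map_add_eq_mul, add_neg_cancel, AddChar.map_zero_eq_one]
      exact mul_right_cancel₀ (hne _ _) (e₁.trans e₂.symm)
    have d' : D (s + s) t = D s t * D s t := AddChar.map_add_eq_mul _ _ _
    rw [add_neg_cancel, AddChar.map_zero_eq_one] at a b
    rw [hg, hg (-s), d, d']
    linear_combination (-g 0 ^ 2 * D s t ^ 2) * a - (g 0 ^ 2 * D s t ^ 2 * α 0 s * α 0 (-s)) * b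
  refine ⟨α 0, β 0, α 1 * (α 0)⁻¹, fun s t => ?_⟩
  rw [hg]
  congr 2
  have e := hconst 0 (s / 2, t) (s / 2 * t, 1) (by simp)
  simp only [symmetricProduct, zero_add, zero_sub, Prod.neg_mk, hsq] at e
  have e' := mul_left_cancel₀ (pow_ne_zero 2 (h0 0)) e
  rwa [show s / 2 + s / 2 = s by field_simp; ring, show s / 2 * t + s / 2 * t = s * t by field_simp; ring] at e'

variable [Fintype F]

theorem exists_mulShift_eq {ψ : AddChar F ℂ} (hψ : ψ.IsPrimitive) (φ : AddChar F ℂ) :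
    ∃ a : F, ∀ x, φ x = ψ (a * x) := by
  have hbij : Function.Bijective ψ.mulShift :=
    (Fintype.bijective_iff_injective_and_card _).mpr
      ⟨AddChar.to_mulShift_inj_of_isPrimitive hψ, AddChar.card_eq.symm⟩
  obtain ⟨a, rfl⟩ := hbij.2 φ
  exact ⟨a, fun x => AddChar.mulShift_apply⟩

theorem exists_isPrimitive_addChar_trace (p : ℕ) [Fact p.Prime] [Algebra (ZMod p) F] :
    ∃ ψ : AddChar F ℂ, ψ.IsPrimitive ∧ ∀ x, ψ x = Complex.exp (2 * (Real.pi : ℂ) * Complex.I *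
      ((Algebra.trace (ZMod p) F x).val : ℂ) / (p : ℂ)) := by
  refine ⟨(ZMod.stdAddChar (N := p)).compAddMonoidHom (Algebra.trace (ZMod p) F).toAddMonoidHom,
    AddChar.IsPrimitive.of_ne_one ?_, fun x => ?_⟩
  · intro h
    obtain ⟨x, hx⟩ := Algebra.trace_surjective (ZMod p) F 1
    have h₁ := DFunLike.congr_fun h x
    simp only [AddChar.compAddMonoidHom_apply, LinearMap.toAddMonoidHom_coe, hx,
      AddChar.one_apply] at h₁
    rw [← (ZMod.stdAddChar (N := p)).map_zero_eq_one] at h₁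
    exact one_ne_zero (ZMod.injective_stdAddChar h₁)
  · rw [AddChar.compAddMonoidHom_apply, LinearMap.toAddMonoidHom_coe]
    have h := ZMod.stdAddChar_coe (N := p) ((Algebra.trace (ZMod p) F x).val : ℤ)
    rwa [Int.cast_natCast, ZMod.natCast_zmod_val, Int.cast_natCast] at h

theorem norm_eq_and_symmetricProduct_eq_iff (h2 : (2 : F) ≠ 0) {ψ : AddChar F ℂ}
    (hψ : ψ.IsPrimitive) {g : F × F → ℂ} (hg : g ≠ 0) :
    ((∀ x y, ‖g x‖ = ‖g y‖) ∧ ∀ x h h' : F × F, h.1 * h.2 = h'.1 * h'.2 →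
      symmetricProduct g x h = symmetricProduct g x h') ↔
    ∃ (lam : ℂ) (a b c : F), lam ≠ 0 ∧ ∀ s t,
      g (s, t) = lam * ψ (a * s + b * t + c * s * t) := by
  constructor
  · rintro ⟨hnorm, hconst⟩
    have h0 : ∀ x, g x ≠ 0 := by
      intro x hx
      exact hg (funext fun y => norm_eq_zero.mp (by rw [hnorm y x, hx, norm_zero]))
    obtain ⟨α, β, χ, h⟩ := exists_addChar_of_symmetricProduct_eq h2 h0 hconst
    obtain ⟨a, ha⟩ := exists_mulShift_eq hψ α
    obtain ⟨b, hb⟩ := exists_mulShift_eq hψ β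
    obtain ⟨c, hc⟩ := exists_mulShift_eq hψ χ
    refine ⟨g 0, a, b, c, h0 0, fun s t => ?_⟩
    rw [h, ha, hb, hc, AddChar.map_add_eq_mul, AddChar.map_add_eq_mul, mul_assoc c]
  · rintro ⟨lam, a, b, c, -, h⟩
    refine ⟨?_, ?_⟩
    · rintro ⟨s, t⟩ ⟨s', t'⟩
      rw [h, h, norm_mul, norm_mul, AddChar.norm_apply, AddChar.norm_apply]
    · rintro ⟨x, y⟩ ⟨s, t⟩ ⟨s', t'⟩ hh
      simp only [symmetricProduct, Prod.mk_add_mk, Prod.mk_sub_mk, h] at hh ⊢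
      simp only [mul_mul_mul_comm lam, ← AddChar.map_add_eq_mul]
      congr 2
      linear_combination (2 * c) * hh

end Characters

section Coordinates

variable {F : Type*} [Field F] [Fintype F] [DecidableEq F]

theorem sum_norm_sq_sum_paraboloid_eq (h2 : (2 : F) ≠ 0) (f : F × F → ℂ) :
    ∑ ξτ : (F × F) × F,
        ‖∑ y ∈ univ.filter (fun y : (F × F) × (F × F) =>
            y.1 + y.2 = ξτ.1 ∧
            (y.1.1 ^ 2 - y.1.2 ^ 2) + (y.2.1 ^ 2 - y.2.2 ^ 2) = ξτ.2),
          f y.1 * f y.2‖ ^ 2 =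
      ∑ x, ∑ t, ‖∑ h : F × F with h.1 * h.2 = t,
        symmetricProduct (fun x => f (x.1 + x.2, x.1 - x.2)) x h‖ ^ 2 := by
  rw [← Fintype.sum_prod_type']
  have h8 : (8 : F) ≠ 0 := by
    rw [show (8 : F) = 2 ^ 3 by norm_num]
    exact pow_ne_zero 3 h2
  have hinj : Function.Injective (fun z : (F × F) × F =>
      (((2 * (z.1.1 + z.1.2), 2 * (z.1.1 - z.1.2)), 8 * (z.1.1 * z.1.2 + z.2)) :
        (F × F) × F)) := by
    rintro ⟨⟨x, y⟩, t⟩ ⟨⟨x', y'⟩, t'⟩ h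
    simp only [Prod.mk.injEq, mul_right_inj' h2, mul_right_inj' h8] at h
    obtain ⟨⟨h₁, h₃⟩, h₄⟩ := h
    have hx : x = x' := mul_left_cancel₀ h2 (by linear_combination h₁ + h₃)
    have hy : y = y' := mul_left_cancel₀ h2 (by linear_combination h₁ - h₃)
    subst hx hy
    simpa using h₄
  refine (Fintype.sum_bijective _ (Finite.injective_iff_bijective.mp hinj) _ _ ?_).symm
  rintro ⟨⟨x, y⟩, t⟩
  congr 2
  refine sum_nbij' (fun h => ((x + h.1 + (y + h.2), x + h.1 - (y + h.2)),
      (x - h.1 + (y - h.2), x - h.1 - (y - h.2))))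
    (fun z => ((z.1.1 + z.1.2) / 2 - x, (z.1.1 - z.1.2) / 2 - y)) ?_ ?_ ?_ ?_ ?_
  · rintro ⟨s, u⟩ h
    simp only [mem_filter, mem_univ, true_and, Prod.mk_add_mk, Prod.mk.injEq] at h ⊢
    refine ⟨⟨by ring, by ring⟩, ?_⟩
    linear_combination 8 * h
  · rintro ⟨⟨a, b⟩, ⟨c, d⟩⟩ h
    simp only [mem_filter, mem_univ, true_and, Prod.mk_add_mk, Prod.mk.injEq] at h ⊢
    obtain ⟨⟨h₁, h₃⟩, h₄⟩ := h
    have hc : c = 2 * (x + y) - a := by linear_combination h₁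
    have hd : d = 2 * (x - y) - b := by linear_combination h₃
    subst hc hd
    field_simp
    refine mul_left_cancel₀ h2 ?_
    linear_combination h₄
  · rintro ⟨s, u⟩ -
    ext
    · field_simp
      ring
    · field_simp
      ring
  · rintro ⟨⟨a, b⟩, ⟨c, d⟩⟩ h
    simp only [mem_filter, mem_univ, true_and, Prod.mk_add_mk, Prod.mk.injEq] at h ⊢
    obtain ⟨⟨h₁, h₃⟩, h₄⟩ := h
    have hc : c = 2 * (x + y) - a := by linear_combination h₁
    have hd : d = 2 * (x - y) - b := by linear_combination h₃
    subst hc hd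
    refine ⟨⟨?_, ?_⟩, ?_, ?_⟩ <;> field_simp <;> ring
  · rintro ⟨s, u⟩ -
    rfl

end Coordinates

/-- Full characterization of the maximizers of the sharp L²→L⁴ extension inequality
from the hyperbolic paraboloid H² ⊂ F³. -/
theorem hyperbolic_paraboloid_maximizers_characterization
    (p n q : ℕ) (hp : p.Prime) (hp2 : p ≠ 2) (hn : 0 < n) (hq : q = p ^ n)
    (F : Type) [Field F] [Fintype F] [DecidableEq F] [Algebra (ZMod p) F]
    (hF : Fintype.card F = q)
    (f : F × F → ℂ) (hf : f ≠ 0) :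
    ((∑ ξτ : (F × F) × F,
        ‖∑ y ∈ univ.filter (fun y : (F × F) × (F × F) =>
            y.1 + y.2 = ξτ.1 ∧
            (y.1.1 ^ 2 - y.1.2 ^ 2) + (y.2.1 ^ 2 - y.2.2 ^ 2) = ξτ.2),
          f y.1 * f y.2‖ ^ 2)
      = ((q : ℝ) + 1 - 1 / q) * (∑ ξ : F × F, ‖f ξ‖ ^ 2) ^ 2)
    ↔ ∃ (lam : ℂ) (a b c : F), lam ≠ 0 ∧ ∀ η ζ : F,
        f (η + ζ, η - ζ)
          = lam * Complex.exp (2 * (Real.pi : ℂ) * Complex.I *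
              ((Algebra.trace (ZMod p) F (a * η + b * ζ + c * η * ζ)).val : ℂ) / (p : ℂ)) := by
  have : Fact p.Prime := ⟨hp⟩
  have : CharP F p := charP_of_injective_algebraMap' (ZMod p) p
  have h2 : (2 : F) ≠ 0 := Ring.two_ne_zero (by rwa [ringChar.eq F p])
  have hbij := bijective_add_sub_s6 (F := F) (V := F) h2
  have hg : (fun x : F × F => f (x.1 + x.2, x.1 - x.2)) ≠ 0 := fun h =>
    hf (funext fun y => by
      obtain ⟨x, rfl⟩ := hbij.2 y
      exact congrFun h x)
  have hsum : ∑ ξ, ‖f ξ‖ ^ 2 = ∑ x : F × F, ‖f (x.1 + x.2, x.1 - x.2)‖ ^ 2 :=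
    (Fintype.sum_bijective _ hbij _ _ fun _ => rfl).symm
  obtain ⟨ψ, hψ, htrace⟩ := exists_isPrimitive_addChar_trace (F := F) p
  rw [sum_norm_sq_sum_paraboloid_eq h2, energy_eq_sub_energyDeficit h2, hsum, hF, sub_eq_self,
    energyDeficit_eq_zero_iff, norm_eq_and_symmetricProduct_eq_iff h2 hψ hg]
  simp only [htrace]
end
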